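/- arXiv:1901.02194 — 4 statements merged into one kernel-verified Lean document; each statement's English description precedes it below -/
import Mathlib

section
/- Let u, v be distinct words with |u| = |v| such that uv is primitive. Then every finite partial order embeds into ({u,v}*, ⊑), the set of all concatenations of copies of u and v ordered by the scattered subword relation. -/
/-- `wpow w n` is the word `w` concatenated `n` times (the `n`-th power of `w`). -/
def wpow {α : Type*} (w : List α) (n : ℕ) : List α :=
  (List.replicate n w).flatten

/-- A word `w ∈ Σ⁺` is primitive if it is nonempty and not a proper power `r^k`, `k ≥ 2`. -/
def Primitive {α : Type*} (w : List α) : Prop :=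
  w ≠ [] ∧ ∀ (r : List α) (k : ℕ), 2 ≤ k → w ≠ wpow r k

/-- `{u,v}*`: the set of all concatenations of copies of `u` and `v`. -/
def star2 {α : Type*} (u v : List α) : Set (List α) :=
  {w | ∃ l : List (List α), (∀ x ∈ l, x = u ∨ x = v) ∧ w = l.flatten}

theorem wpow_zero' {A : Type*} (r : List A) : wpow r 0 = [] := by simp [wpow]

theorem wpow_succ' {A : Type*} (r : List A) (n : ℕ) : wpow r (n+1) = r ++ wpow r n := by
  simp [wpow, List.replicate_succ]

theorem wpow_add' {A : Type*} (r : List A) (m n : ℕ) :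
    wpow r (m+n) = wpow r m ++ wpow r n := by
  rw [wpow, List.replicate_add, List.flatten_append]; rfl

theorem wpow_one' {A : Type*} (r : List A) : wpow r 1 = r := by simp [wpow]

theorem wpow_succ_right {A : Type*} (r : List A) (n : ℕ) :
    wpow r (n+1) = wpow r n ++ r := by
  rw [wpow_add', wpow_one']

theorem wpow_length {A : Type*} (r : List A) (n : ℕ) : (wpow r n).length = n * r.length := by
  simp [wpow]

theorem comm_powers {A : Type*} (n : ℕ) : ∀ a z : List A, a.length + z.length ≤ n →
    a ++ z = z ++ a → ∃ r i j, a = wpow r i ∧ z = wpow r j := by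
  induction n with
  | zero =>
    intro a z hl _
    have ha : a = [] := List.length_eq_zero_iff.mp (by omega)
    have hz : z = [] := List.length_eq_zero_iff.mp (by omega)
    exact ⟨[], 0, 0, by simp [ha, hz, wpow]⟩
  | succ n ih =>
    intro a z hl h
    by_cases ha : a = []
    · exact ⟨z, 0, 1, by simp [ha, wpow]⟩
    by_cases hz : z = []
    · exact ⟨a, 1, 0, by simp [hz, wpow]⟩
    have ha' := List.length_pos_iff.mpr ha
    have hz' := List.length_pos_iff.mpr hz
    rcases List.append_eq_append_iff.mp h with ⟨c, h1, h2⟩ | ⟨c, h1, h2⟩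
    · -- z = a ++ c
      subst h1
      simp only [List.length_append] at hl
      obtain ⟨r, i, j, e1, e2⟩ := ih a c (by omega) (by
        simpa using h)
      exact ⟨r, i, i + j, e1, by rw [wpow_add', ← e1, ← e2]⟩
    · subst h1
      simp only [List.length_append] at hl
      obtain ⟨r, i, j, e1, e2⟩ := ih c z (by omega) (by
        simpa using h)
      exact ⟨r, j + i, j, by rw [wpow_add', ← e1, ← e2], e2⟩

theorem prim_rot {A : Type*} {a z : List A} (h : Primitive (a ++ z)) (ha : a ≠ [])
    (hz : z ≠ []) : z ++ a ≠ a ++ z := by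
  intro he
  obtain ⟨r, i, j, e1, e2⟩ := comm_powers _ a z le_rfl he.symm
  have hi : i ≠ 0 := by rintro rfl; exact ha (by simpa [wpow] using e1)
  have hj : j ≠ 0 := by rintro rfl; exact hz (by simpa [wpow] using e2)
  exact h.2 r (i + j) (by omega) (by rw [wpow_add', ← e1, ← e2])

/-- Reading a block `c` that differs from the next block `b x` leaves the letter `x` unread. -/
theorem lose_one {A : Type*} {b c s t : List A} {x : A} (hl : b.length + 1 = c.length)
    (hne : b ++ [x] ≠ c) (h : (b ++ [x] ++ s).Sublist (c ++ t)) : (x :: s).Sublist t := by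
  obtain ⟨l1, l2, e, h1, h2⟩ := List.sublist_append_iff.mp h
  have hle := h1.length_le
  have hlt : l1.length < c.length := by
    rcases hle.lt_or_eq with h' | h'
    · exact h'
    · exfalso
      have := h1.eq_of_length h'
      subst this
      exact hne (List.append_inj e (by simp; omega)).1
  rw [List.append_assoc] at e
  rcases List.append_eq_append_iff.mp e with ⟨d, e1, e2⟩ | ⟨d, e1, e2⟩
  · have : d = [] := by
      apply List.length_eq_zero_iff.mp
      have := congrArg List.length e1
      simp at this; omega
    subst this
    simp at e2
    rw [e2]; exact h2
  · rw [e2] at h2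
    exact (List.sublist_append_right d _).trans (by simpa using h2)

theorem cancel_len {A : Type*} {a b c d : List A} (hl : c.length ≤ a.length)
    (h : (a ++ b).Sublist (c ++ d)) : b.Sublist d := by
  obtain ⟨l1, l2, e, h1, h2⟩ := List.sublist_append_iff.mp h
  have hle := h1.length_le
  rcases List.append_eq_append_iff.mp e with ⟨e', e1, e2⟩ | ⟨e', e1, e2⟩
  · have : e' = [] := by
      apply List.length_eq_zero_iff.mp
      have := congrArg List.length e1
      simp at this; omega
    subst this
    simp at e2
    rw [e2]; exact h2
  · rw [e2] at h2
    exact (List.sublist_append_right e' _).trans h2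

theorem sync {A : Type*} {w : List A} (hw : Primitive w) (m : ℕ) :
    ∀ (a z s t : List A) (K : ℕ), a.length = m → w = a ++ z → z ≠ [] → m ≤ K →
      (z ++ (wpow w K ++ s)).Sublist (wpow w (K+1) ++ t) → s.Sublist t := by
  induction m with
  | zero =>
    intro a z s t K ha hwz _ _ h
    have : a = [] := List.length_eq_zero_iff.mp ha
    subst this
    simp at hwz
    subst hwz
    rw [wpow_succ', List.append_assoc, List.append_sublist_append_left,
      List.append_sublist_append_left] at h
    exact h
  | succ m ih =>
    intro a z s t K ha hwz hz hK h
    obtain ⟨K, rfl⟩ : ∃ k, K = k + 1 := ⟨K - 1, by omega⟩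
    have hane : a ≠ [] := by rintro rfl; simp at ha
    obtain ⟨b, x, rfl⟩ : ∃ b x, a = b ++ [x] :=
      ⟨a.dropLast, a.getLast hane, (List.dropLast_append_getLast hane).symm⟩
    have hrot := prim_rot (hwz ▸ hw) hane hz
    rw [← hwz] at hrot
    refine ih b (x :: z) s t K (by simpa using ha) (by simp [hwz]) (by simp) (by omega) ?_
    rw [wpow_succ' w (K+1), List.append_assoc] at h
    have := lose_one (b := z ++ b) (c := w) (x := x) (s := z ++ (wpow w K ++ s))
      (t := wpow w (K+1) ++ t) (by rw [hwz]; simp; omega) (by simpa using hrot) (by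
        have e : z ++ b ++ [x] ++ (z ++ (wpow w K ++ s)) = z ++ (wpow w (K+1) ++ s) := by
          rw [wpow_succ']
          nth_rewrite 2 [hwz]
          simp
        rw [e]; exact h)
    simpa using this

theorem skip {A : Type*} {w c s t : List A} (hw : Primitive w) (hc : c.length = w.length)
    (hne : w ≠ c) (h : (wpow w w.length ++ s).Sublist (c ++ (wpow w w.length ++ t))) :
    s.Sublist t := by
  have hn := List.length_pos_iff.mpr hw.1
  obtain ⟨b, x, hbx⟩ : ∃ b x, w = b ++ [x] :=
    ⟨w.dropLast, w.getLast hw.1, (List.dropLast_append_getLast hw.1).symm⟩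
  have hbl : w.length = b.length + 1 := by rw [hbx]; simp
  rw [hbl] at h
  nth_rewrite 1 [wpow_succ'] at h
  refine sync hw b.length b [x] s t b.length rfl hbx (by simp) le_rfl ?_
  have := lose_one (b := b) (c := c) (x := x) (s := wpow w b.length ++ s)
    (t := wpow w (b.length+1) ++ t) (by omega) (by rw [← hbx]; exact hne) (by
      rw [← hbx]; simpa using h)
  simpa using this

def enc {A P : Type*} (w c : List A) (f : P → Bool) : List P → List A
  | [] => []
  | q :: L => (if f q then c else []) ++ (wpow w w.length ++ enc w c f L)

theorem enc_mono {A P : Type*} (w c : List A) (f g : P → Bool) (h : ∀ q, f q → g q)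
    (L : List P) : (enc w c f L).Sublist (enc w c g L) := by
  induction L with
  | nil => simp [enc]
  | cons q L ih =>
    unfold enc
    refine List.Sublist.append ?_ ((List.append_sublist_append_left _).mpr ih)
    have := h q
    cases hf : f q <;> cases hg : g q <;> simp_all

theorem lag {A P : Type*} {w c : List A} (hw : Primitive w) (hc : c.length = w.length)
    (hne : w ≠ c) (f g : P → Bool) (L : List P) :
    ¬ (w ++ enc w c f L).Sublist (enc w c g L) := by
  have hn := List.length_pos_iff.mpr hw.1
  obtain ⟨k, hk⟩ : ∃ k, w.length = k + 1 := ⟨w.length - 1, by omega⟩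
  have hswap : w ++ wpow w w.length = wpow w w.length ++ w := by
    rw [← wpow_succ', wpow_succ_right]
  induction L with
  | nil => simp [enc, hw.1]
  | cons q L ih =>
    intro h
    apply ih
    unfold enc at h
    cases hf : f q <;> cases hg : g q <;> simp only [hf, hg, if_true, if_false, List.nil_append,
      Bool.false_eq_true] at h
    · rw [← List.append_assoc, hswap, List.append_assoc, List.append_sublist_append_left] at h
      exact h
    · rw [← List.append_assoc, hswap, List.append_assoc] at h
      exact skip hw hc hne h
    · refine cancel_len (a := w ++ c ++ wpow w k) (c := wpow w w.length) ?_ ?_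
      · simp only [List.length_append, wpow_length, hc]
        conv_lhs => rw [hk, Nat.add_mul, ← hk]
        omega
      · have e : wpow w w.length = wpow w k ++ w := by rw [hk, wpow_succ_right]
        convert h using 1
        rw [e]; simp
    · refine cancel_len (a := w ++ c ++ wpow w k) (c := c ++ wpow w w.length) ?_ ?_
      · simp only [List.length_append, wpow_length, hc]
        conv_lhs => rw [hk, Nat.add_mul, ← hk]
        omega
      · have e : wpow w w.length = wpow w k ++ w := by rw [hk, wpow_succ_right]
        convert h using 1
        · rw [e]; simp
        · simp

theorem enc_reflect {A P : Type*} {w c : List A} (hw : Primitive w) (hc : c.length = w.length)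
    (hne : w ≠ c) (f g : P → Bool) (L : List P)
    (h : (enc w c f L).Sublist (enc w c g L)) : ∀ q ∈ L, f q → g q := by
  have hn := List.length_pos_iff.mpr hw.1
  obtain ⟨k, hk⟩ : ∃ k, w.length = k + 1 := ⟨w.length - 1, by omega⟩
  induction L with
  | nil => simp
  | cons q L ih =>
    unfold enc at h
    have key : (f q → g q) ∧ (enc w c f L).Sublist (enc w c g L) := by
      cases hf : f q <;> cases hg : g q <;> simp only [hf, hg, if_true, if_false,
        List.nil_append, Bool.false_eq_true] at h
      · simpa using h
      · simpa using skip hw hc hne h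
      · exfalso
        apply lag hw hc hne f g L
        refine cancel_len (a := c ++ wpow w k) (c := wpow w w.length) ?_ ?_
        · simp only [List.length_append, wpow_length, hc]
          conv_lhs => rw [hk, Nat.add_mul, ← hk]
          omega
        · have e : wpow w w.length = wpow w k ++ w := by rw [hk, wpow_succ_right]
          convert h using 1
          rw [e]; simp
      · simpa using h
    intro r hr
    rcases List.mem_cons.mp hr with rfl | hr
    · exact key.1
    · exact ih key.2 r hr

theorem star2_append {A : Type*} {u v a b : List A} (ha : a ∈ star2 u v) (hb : b ∈ star2 u v) :
    a ++ b ∈ star2 u v := by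
  obtain ⟨l, hl, rfl⟩ := ha
  obtain ⟨m, hm, rfl⟩ := hb
  refine ⟨l ++ m, ?_, by simp⟩
  intro x hx
  rcases List.mem_append.mp hx with h | h
  · exact hl x h
  · exact hm x h

theorem star2_nil {A : Type*} (u v : List A) : [] ∈ star2 u v := ⟨[], by simp, by simp⟩

theorem star2_wpow {A : Type*} {u v a : List A} (ha : a ∈ star2 u v) (n : ℕ) :
    wpow a n ∈ star2 u v := by
  induction n with
  | zero => rw [wpow_zero']; exact star2_nil u v
  | succ n ih => rw [wpow_succ']; exact star2_append ha ih

theorem enc_mem {A P : Type*} {u v w c : List A} (hw : w ∈ star2 u v) (hc : c ∈ star2 u v)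
    (f : P → Bool) (L : List P) : enc w c f L ∈ star2 u v := by
  induction L with
  | nil => exact star2_nil u v
  | cons q L ih =>
    unfold enc
    refine star2_append ?_ (star2_append (star2_wpow hw _) ih)
    split
    · exact hc
    · exact star2_nil u v

/-- If `u ≠ v`, `|u| = |v|`, and `uv` is primitive, then every finite partial order
embeds into `({u,v}*, ⊑)`. -/
theorem finite_partial_order_embeds {A : Type*} (u v : List A) (huv : u ≠ v)
    (hlen : u.length = v.length) (hprim : Primitive (u ++ v))
    (P : Type) [Fintype P] [PartialOrder P] :
    ∃ f : P → List A, (∀ p, f p ∈ star2 u v) ∧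
      ∀ p q : P, p ≤ q ↔ (f p).Sublist (f q) := by
  classical
  have hu : u ∈ star2 u v := ⟨[u], by simp, by simp⟩
  have hv : v ∈ star2 u v := ⟨[v], by simp, by simp⟩
  refine ⟨fun p => enc (u ++ v) (v ++ u) (fun q => decide (q ≤ p)) Finset.univ.toList,
    fun p => enc_mem (star2_append hu hv) (star2_append hv hu) _ _, fun p q => ⟨?_, ?_⟩⟩
  · intro h
    apply enc_mono
    intro r hr
    simp only [decide_eq_true_eq] at hr ⊢
    exact hr.trans h
  · intro h
    have := enc_reflect hprim (by simp; omega)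
      (fun e => huv (List.append_inj e hlen).1) _ _ _ h p (by simp)
    simpa using this
end

section
/- Let K ⊆ Σ* be context-free, w₁,…,w_n ∈ Σ*, and define g : ℕⁿ → Σ* by g(m₁,…,m_n) = w₁^{m₁} w₂^{m₂} ⋯ w_n^{m_n}. Then the set g⁻¹(K) = {m ∈ ℕⁿ : g(m) ∈ K} is a semilinear subset of ℕⁿ. -/
/-- A linear subset of a commutative monoid: `{b + λ₁p₁ + ⋯ + λ_k p_k : λ_i ∈ ℕ}`. -/
def IsLinear {M : Type*} [AddCommMonoid M] (S : Set M) : Prop :=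
  ∃ (b : M) (k : ℕ) (p : Fin k → M),
    S = {x | ∃ c : Fin k → ℕ, x = b + ∑ i, c i • p i}

/-- A semilinear set is a finite union of linear sets. -/
def IsSemilinear {M : Type*} [AddCommMonoid M] (S : Set M) : Prop :=
  ∃ (m : ℕ) (T : Fin m → Set M), (∀ i, IsLinear (T i)) ∧ S = ⋃ i, T i

namespace PreimageCF

/-! ### Commutative grammars -/

section Comm

variable {N R : Type} (inp : R → N) (out : R → Multiset N)

/-- `Run s τ`: the multiset of nonterminals `s` can be rewritten to the empty multiset,
using exactly the multiset `τ` of rules. -/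
inductive Run : Multiset N → Multiset R → Prop
  | nil : Run 0 0
  | step (r : R) (s : Multiset N) (τ : Multiset R) :
      Run (out r + s) τ → Run (inp r ::ₘ s) (r ::ₘ τ)

/-- Nonterminals reachable from `S` by rules in `T`. -/
inductive Reach (S : Multiset N) (T : Set R) : N → Prop
  | base (X : N) : X ∈ S → Reach S T X
  | step (r : R) (Y : N) : r ∈ T → Reach S T (inp r) → Y ∈ out r → Reach S T Y

variable {inp out}

lemma Reach.mono {S : Multiset N} {T T' : Set R} (hT : T ⊆ T') {X : N}
    (h : Reach inp out S T X) : Reach inp out S T' X := by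
  induction h with
  | base X hX => exact .base X hX
  | step r Y hr _ hY ih => exact .step r Y (hT hr) ih hY

lemma Run.balance {s : Multiset N} {τ : Multiset R} (h : Run inp out s τ) :
    s + (τ.map out).sum = τ.map inp ∧ ∀ r ∈ τ, Reach inp out s {r | r ∈ τ} (inp r) := by
  induction h with
  | nil => simp
  | step r s τ _ ih =>
    obtain ⟨h1, h2⟩ := ih
    constructor
    · simp only [Multiset.map_cons, Multiset.sum_cons, Multiset.cons_add, ← h1]
      congr 1
      abel
    · have key : ∀ X, Reach inp out (out r + s) {r | r ∈ τ} X →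
          Reach inp out (inp r ::ₘ s) {r' | r' ∈ r ::ₘ τ} X := by
        intro X hX
        induction hX with
        | base X hX =>
          rcases Multiset.mem_add.1 hX with h | h
          · exact .step r X (by simp) (.base _ (by simp)) h
          · exact .base X (by simp [h])
        | step r' Y hr _ hY ih =>
          refine .step r' Y ?_ ih hY
          simp only [Set.mem_ofPred_eq] at hr ⊢
          simp [hr]
      intro r' hr'
      rcases Multiset.mem_cons.1 hr' with rfl | hr'
      · exact .base _ (by simp)
      · exact key _ (h2 r' hr')

lemma mem_map_sum {τ : Multiset R} {X : N} : X ∈ (τ.map out).sum ↔ ∃ r ∈ τ, X ∈ out r := by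
  induction τ using Multiset.induction_on with
  | empty => simp
  | cons a τ ih => simp [ih]

lemma run_of_balance (k : ℕ) : ∀ (s : Multiset N) (τ : Multiset R), τ.card = k →
    s + (τ.map out).sum = τ.map inp →
    (∀ r ∈ τ, Reach inp out s {r | r ∈ τ} (inp r)) → Run inp out s τ := by
  induction k with
  | zero =>
    intro s τ hk h1 _
    rw [Multiset.card_eq_zero] at hk
    subst hk
    simp at h1
    subst h1
    exact .nil
  | succ k ih =>
    intro s τ hk h1 h2
    have hs : ∃ X, X ∈ s := by
      by_contra hs
      push Not at hs
      obtain ⟨r, hr⟩ := Multiset.card_pos_iff_exists_mem.1 (by omega : 0 < τ.card)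
      have key : ∀ X, ¬ Reach inp out s {r | r ∈ τ} X := by
        intro X hX
        induction hX with
        | base X hX => exact hs X hX
        | step _ _ _ _ _ ih => exact ih
      exact key _ (h2 r hr)
    obtain ⟨X, hX⟩ := hs
    obtain ⟨s0, rfl⟩ := Multiset.exists_cons_of_mem hX
    have hXτ : X ∈ τ.map inp := by rw [← h1]; simp
    -- choose a good rule
    have good : ∃ r τ', τ = r ::ₘ τ' ∧ inp r = X ∧
        (X ∈ τ'.map inp → Reach inp out (out r + s0) {r | r ∈ τ'} X) := by
      by_contra hcon
      push Not at hcon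
      obtain ⟨r0, hr0, hr0X⟩ := Multiset.mem_map.1 hXτ
      obtain ⟨τ0, rfl⟩ := Multiset.exists_cons_of_mem hr0
      obtain ⟨hX0, hn0⟩ := hcon r0 τ0 rfl hr0X
      have hbal : out r0 + s0 + (τ0.map out).sum = τ0.map inp := by
        simp only [Multiset.map_cons, Multiset.sum_cons, Multiset.cons_add, hr0X] at h1
        rw [Multiset.cons_inj_right] at h1
        rw [← h1]; abel
      have hX1 : ∃ r' ∈ τ0, X ∈ out r' := by
        rw [← hbal, Multiset.mem_add] at hX0
        rcases hX0 with h | h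
        · exact absurd (.base _ h) hn0
        · exact mem_map_sum.1 h
      obtain ⟨r', hr', hXr'⟩ := hX1
      have hr'τ : r' ∈ r0 ::ₘ τ0 := Multiset.mem_cons_of_mem hr'
      have claim : ∀ W, Reach inp out (X ::ₘ s0) {r | r ∈ r0 ::ₘ τ0} W → W = X ∨
          ∃ r ∈ r0 ::ₘ τ0, inp r = X ∧
            Reach inp out (out r + s0) {ρ | ρ ∈ r0 ::ₘ τ0 ∧ inp ρ ≠ X} W := by
        intro W hW
        induction hW with
        | base W hW =>
          rcases Multiset.mem_cons.1 hW with h | h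
          · exact .inl h
          · exact .inr ⟨r0, by simp, hr0X, .base _ (by simp [h])⟩
        | step ρ Y hρ _ hY ih =>
          right
          by_cases hρX : inp ρ = X
          · exact ⟨ρ, hρ, hρX, .base _ (by simp [hY])⟩
          · rcases ih with h | ⟨r, hr, hrX, h⟩
            · exact absurd h hρX
            · exact ⟨r, hr, hrX, .step ρ Y ⟨hρ, hρX⟩ h hY⟩
      have fin : ∃ r ∈ r0 ::ₘ τ0, inp r = X ∧
            Reach inp out (out r + s0) {ρ | ρ ∈ r0 ::ₘ τ0 ∧ inp ρ ≠ X} X := by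
        by_cases hZ : inp r' = X
        · exact ⟨r', hr'τ, hZ, .base _ (by simp [hXr'])⟩
        · rcases claim _ (h2 r' hr'τ) with h | ⟨r, hr, hrX, h⟩
          · exact absurd h hZ
          · exact ⟨r, hr, hrX, .step r' X ⟨hr'τ, hZ⟩ h hXr'⟩
      obtain ⟨r, hr, hrX, hreach⟩ := fin
      obtain ⟨τ', hτ'⟩ := Multiset.exists_cons_of_mem hr
      refine (hcon r τ' hτ' hrX).2 (hreach.mono ?_)
      rintro ρ ⟨hρ, hρX⟩
      rw [hτ'] at hρ
      rcases Multiset.mem_cons.1 hρ with h | h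
      · exact absurd (h ▸ hrX) hρX
      · exact h
    obtain ⟨r, τ', rfl, rfl, hgood⟩ := good
    refine .step r s0 τ' (ih _ _ (by simpa using hk) ?_ ?_)
    · simp only [Multiset.map_cons, Multiset.sum_cons, Multiset.cons_add] at h1
      rw [Multiset.cons_inj_right] at h1
      rw [← h1]; abel
    · have key : ∀ W, Reach inp out (inp r ::ₘ s0) {ρ | ρ ∈ r ::ₘ τ'} W →
          W = inp r ∨ Reach inp out (out r + s0) {ρ | ρ ∈ τ'} W := by
        intro W hW
        induction hW with
        | base W hW =>
          rcases Multiset.mem_cons.1 hW with h | h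
          · exact .inl h
          · exact .inr (.base _ (by simp [h]))
        | step ρ Y hρ _ hY ih =>
          right
          rcases Multiset.mem_cons.1 hρ with h | h
          · subst h
            exact .base _ (by simp [hY])
          · refine .step ρ Y h ?_ hY
            rcases ih with h' | h'
            · rw [h']
              exact hgood (h' ▸ Multiset.mem_map_of_mem inp h)
            · exact h'
      intro ρ hρ
      rcases key _ (h2 ρ (Multiset.mem_cons_of_mem hρ)) with h | h
      · rw [h]
        exact hgood (h ▸ Multiset.mem_map_of_mem inp hρ)
      · exact h

lemma multiset_fg [Finite R] : AddMonoid.FG (Multiset R) := by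
  refine ⟨(AddSubmonoid.fg_iff _).2 ⟨Set.range fun r : R => ({r} : Multiset R), ?_,
    Set.finite_range _⟩⟩
  rw [eq_top_iff]
  intro τ _
  induction τ using Multiset.induction_on with
  | empty => exact zero_mem _
  | cons a τ ih =>
    rw [← Multiset.singleton_add]
    exact add_mem (AddSubmonoid.subset_closure ⟨a, rfl⟩) (ih trivial)

lemma semilinear_run [Finite R] (s : Multiset N) : IsSemilinearSet {τ | Run inp out s τ} := by
  classical
  have := multiset_fg (R := R)
  have hsupp : ∀ T : Set R, IsSemilinearSet {τ : Multiset R | {r | r ∈ τ} = T} := by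
    intro T
    have h0 : ∀ r : R, IsSemilinearSet {τ : Multiset R | r ∉ τ} := by
      intro r
      have := isSemilinearSet_setOfPred_eq (M := Multiset R) (0 : ℕ) 0
        (Multiset.countAddMonoidHom r) (0 : Multiset R →+ ℕ)
      simpa using this
    have : {τ : Multiset R | {r | r ∈ τ} = T} =
        ⋂ r : R, if r ∈ T then {τ : Multiset R | r ∉ τ}ᶜ else {τ : Multiset R | r ∉ τ} := by
      ext τ
      simp only [Set.mem_ofPred_eq, Set.mem_iInter, Set.ext_iff]
      refine forall_congr' fun r => ?_
      by_cases hr : r ∈ T <;> simp [hr]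
    rw [this]
    refine .iInter fun r => ?_
    split_ifs
    · exact (h0 r).compl
    · exact h0 r
  have heq : IsSemilinearSet {τ : Multiset R | s + (τ.map out).sum = τ.map inp} := by
    have := isSemilinearSet_setOfPred_eq (M := Multiset R) s 0
      (Multiset.sumAddMonoidHom.comp (Multiset.mapAddMonoidHom out)) (Multiset.mapAddMonoidHom inp)
    simpa using this
  have : {τ | Run inp out s τ} =
      ⋃ T ∈ {T : Set R | ∀ r ∈ T, Reach inp out s T (inp r)},
        ({τ : Multiset R | {r | r ∈ τ} = T} ∩
          {τ : Multiset R | s + (τ.map out).sum = τ.map inp}) := by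
    ext τ
    simp only [Set.mem_ofPred_eq, Set.mem_iUnion, Set.mem_inter_iff, exists_prop]
    constructor
    · intro h
      exact ⟨_, h.balance.2, rfl, h.balance.1⟩
    · rintro ⟨T, hT, rfl, h⟩
      exact run_of_balance _ s τ rfl h hT
  rw [this]
  exact .biUnion (Set.toFinite _) fun T _ => (hsupp T).inter heq

end Comm

/-! ### Annotated sentential forms -/

section Annot

variable {A Q M : Type} [AddCommMonoid M] (g : ContextFreeGrammar A)
  (E : Q → A → Q → Prop) (c : Q → Q → M)

/-- `Ann α p q s m`: the sentential form `α` can be annotated by a path from `p` to `q` in the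
automaton, where nonterminals jump arbitrarily; `s` collects the annotated nonterminals and
`m` the weight of the terminal steps. -/
def Ann {T : Type} : List (Symbol A T) → Q → Q → Multiset (T × Q × Q) → M → Prop
  | [], p, q, s, m => p = q ∧ s = 0 ∧ m = 0
  | Symbol.terminal a :: α, p, q, s, m =>
      ∃ p' m', E p a p' ∧ m = c p p' + m' ∧ Ann α p' q s m'
  | Symbol.nonterminal X :: α, p, q, s, m =>
      ∃ p' s', s = (X, p, p') ::ₘ s' ∧ Ann α p' q s' m

variable {T : Type}

lemma ann_append (α β : List (Symbol A T)) : ∀ (p q : Q) (s : Multiset (T × Q × Q)) (m : M),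
    Ann E c (α ++ β) p q s m ↔ ∃ p' s1 s2 m1 m2, s = s1 + s2 ∧ m = m1 + m2 ∧
      Ann E c α p p' s1 m1 ∧ Ann E c β p' q s2 m2 := by
  induction α with
  | nil =>
    intro p q s m
    simp only [List.nil_append, Ann]
    constructor
    · intro h
      exact ⟨p, 0, s, 0, m, by simp, by simp, ⟨rfl, rfl, rfl⟩, h⟩
    · rintro ⟨p', s1, s2, m1, m2, rfl, rfl, ⟨rfl, rfl, rfl⟩, h⟩
      simpa using h
  | cons x α ih =>
    intro p q s m
    cases x with
    | terminal a =>
      simp only [List.cons_append, Ann, ih]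
      constructor
      · rintro ⟨p', m', hE, rfl, p'', s1, s2, m1, m2, rfl, rfl, h1, h2⟩
        exact ⟨p'', s1, s2, c p p' + m1, m2, rfl, by rw [add_assoc], ⟨p', m1, hE, rfl, h1⟩, h2⟩
      · rintro ⟨p'', s1, s2, m1, m2, rfl, rfl, ⟨p', m', hE, rfl, h1⟩, h2⟩
        exact ⟨p', m' + m2, hE, by rw [add_assoc], p'', s1, s2, m', m2, rfl, rfl, h1, h2⟩
    | nonterminal X =>
      simp only [List.cons_append, Ann, ih]
      constructor
      · rintro ⟨p', s', rfl, p'', s1, s2, m1, m2, rfl, rfl, h1, h2⟩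
        exact ⟨p'', (X, p, p') ::ₘ s1, s2, m1, m2, by simp, rfl, ⟨p', s1, rfl, h1⟩, h2⟩
      · rintro ⟨p'', s1, s2, m1, m2, rfl, rfl, ⟨p', s', rfl, h1⟩, h2⟩
        exact ⟨p', s' + s2, by simp, p'', s', s2, m1, m2, rfl, rfl, h1, h2⟩

lemma ann_zero (α : List (Symbol A T)) : ∀ (p q : Q) (m : M), Ann E c α p q 0 m →
    ∃ u : List A, α = u.map Symbol.terminal := by
  induction α with
  | nil => intro _ _ _ _; exact ⟨[], rfl⟩
  | cons x α ih =>
    intro p q m h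
    cases x with
    | terminal a =>
      obtain ⟨p', m', _, _, h⟩ := h
      obtain ⟨u, rfl⟩ := ih _ _ _ h
      exact ⟨a :: u, rfl⟩
    | nonterminal X =>
      obtain ⟨p', s', h, _⟩ := h
      exact absurd h.symm (Multiset.cons_ne_zero)

lemma ann_terminal (u : List A) : ∀ (p q : Q) (s : Multiset (T × Q × Q)) (m : M),
    Ann E c (u.map Symbol.terminal) p q s m → s = 0 := by
  induction u with
  | nil => intro p q s m h; exact h.2.1
  | cons a u ih =>
    rintro p q s m ⟨p', m', _, _, h⟩
    exact ih _ _ _ _ h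

lemma ann_cons (X : T) (p1 p2 : Q) (α : List (Symbol A T)) :
    ∀ (p q : Q) (s : Multiset (T × Q × Q)) (m : M), Ann E c α p q ((X, p1, p2) ::ₘ s) m →
    ∃ α1 α2 s1 s2 m1 m2, α = α1 ++ [Symbol.nonterminal X] ++ α2 ∧ s = s1 + s2 ∧ m = m1 + m2 ∧
      Ann E c α1 p p1 s1 m1 ∧ Ann E c α2 p2 q s2 m2 := by
  induction α with
  | nil =>
    rintro p q s m ⟨_, h, _⟩
    exact absurd h (Multiset.cons_ne_zero)
  | cons x α ih =>
    intro p q s m h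
    cases x with
    | terminal a =>
      obtain ⟨p', m', hE, rfl, h⟩ := h
      obtain ⟨α1, α2, s1, s2, m1, m2, rfl, rfl, rfl, h1, h2⟩ := ih _ _ _ _ h
      exact ⟨Symbol.terminal a :: α1, α2, s1, s2, c p p' + m1, m2, by simp, rfl,
        by rw [add_assoc], ⟨p', m1, hE, rfl, h1⟩, h2⟩
    | nonterminal Y =>
      obtain ⟨p', s', hs, h⟩ := h
      rcases Multiset.cons_eq_cons.1 hs with ⟨h1, rfl⟩ | ⟨_, cs, rfl, rfl⟩
      · simp only [Prod.mk.injEq] at h1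
        obtain ⟨rfl, rfl, rfl⟩ := h1
        exact ⟨[], α, 0, s, 0, m, by simp, by simp, by simp, ⟨rfl, rfl, rfl⟩, h⟩
      · obtain ⟨α1, α2, s1, s2, m1, m2, rfl, rfl, rfl, h1, h2⟩ := ih _ _ _ _ h
        exact ⟨Symbol.nonterminal Y :: α1, α2, (Y, p, p') ::ₘ s1, s2, m1, m2, by simp, by simp,
          rfl, ⟨p', s1, rfl, h1⟩, h2⟩

lemma ann_finite [Finite Q] (α : List (Symbol A T)) : ∀ p q : Q,
    {x : Multiset (T × Q × Q) × M | Ann E c α p q x.1 x.2}.Finite := by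
  induction α with
  | nil =>
    intro p q
    refine (Set.finite_singleton (0, 0)).subset ?_
    rintro ⟨s, m⟩ ⟨_, rfl, rfl⟩
    rfl
  | cons x α ih =>
    intro p q
    cases x with
    | terminal a =>
      refine (Set.finite_iUnion fun p' : Q => (ih p' q).image fun x => (x.1, c p p' + x.2)).subset ?_
      rintro ⟨s, m⟩ ⟨p', m', hE, hm, h⟩
      exact Set.mem_iUnion.2 ⟨p', (s, m'), h, Prod.ext rfl hm.symm⟩
    | nonterminal X =>
      refine (Set.finite_iUnion fun p' : Q =>
        (ih p' q).image fun x => ((X, p, p') ::ₘ x.1, x.2)).subset ?_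
      rintro ⟨s, m⟩ ⟨p', s', hs, h⟩
      exact Set.mem_iUnion.2 ⟨p', (s', m), h, Prod.ext hs.symm rfl⟩

/-- The annotated rules. -/
def ruleSet : Set ((g.NT × Q × Q) × (Multiset (g.NT × Q × Q) × M)) :=
  {x | ∃ r ∈ g.rules, r.input = x.1.1 ∧ Ann E c r.output x.1.2.1 x.1.2.2 x.2.1 x.2.2}

lemma ruleSet_finite [Finite Q] : (ruleSet g E c).Finite := by
  refine (g.rules.finite_toSet.biUnion fun r _ => Set.finite_iUnion fun p : Q =>
    Set.finite_iUnion fun q : Q =>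
      (ann_finite E c r.output p q).image fun x => ((r.input, p, q), x)).subset ?_
  rintro ⟨⟨X, p, q⟩, x⟩ ⟨r, hr, hX, h⟩
  simp only [Set.mem_iUnion]
  refine ⟨r, hr, p, q, x, h, ?_⟩
  simp only at hX
  rw [hX]

/-- Left-hand side of annotated rules. -/
def rInp (r : ruleSet g E c) : g.NT × Q × Q := r.1.1
/-- Nonterminals of the right-hand side of annotated rules. -/
def rOut (r : ruleSet g E c) : Multiset (g.NT × Q × Q) := r.1.2.1
/-- Weight of annotated rules. -/
def rWt (r : ruleSet g E c) : M := r.1.2.2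

lemma derives_run {α β : List (Symbol A g.NT)} (h : g.Derives α β) {p q : Q} {m : M}
    (hβ : Ann E c β p q 0 m) :
    ∃ s m0 τ, Ann E c α p q s m0 ∧ Run (rInp g E c) (rOut g E c) s τ ∧
      m = m0 + (τ.map (rWt g E c)).sum := by
  induction h using Relation.ReflTransGen.head_induction_on with
  | refl => exact ⟨0, m, 0, hβ, .nil, by simp⟩
  | head hp _ ih =>
    obtain ⟨s, m0, τ, hA, hR, rfl⟩ := ih
    obtain ⟨r, hr, hrw⟩ := hp
    obtain ⟨x, y, rfl, rfl⟩ := hrw.exists_parts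
    rw [ann_append] at hA
    obtain ⟨p2, s1, s3, m1, m3, rfl, rfl, hA, h3⟩ := hA
    rw [ann_append] at hA
    obtain ⟨p1, s1, s2, m1, m2, rfl, rfl, h1, h2⟩ := hA
    let ρ : ruleSet g E c := ⟨((r.input, p1, p2), (s2, m2)), r, hr, rfl, h2⟩
    refine ⟨(r.input, p1, p2) ::ₘ (s1 + s3), m1 + m3, ρ ::ₘ τ, ?_, ?_, ?_⟩
    · rw [ann_append]
      refine ⟨p2, (r.input, p1, p2) ::ₘ s1, s3, m1, m3, by simp, rfl, ?_, h3⟩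
      rw [ann_append]
      refine ⟨p1, s1, {(r.input, p1, p2)}, m1, 0, ?_, by simp, h1, p2, 0, rfl, rfl, rfl, rfl⟩
      rw [add_comm, Multiset.singleton_add]
    · refine Run.step (inp := rInp g E c) (out := rOut g E c) ρ _ _ ?_
      have : rOut g E c ρ + (s1 + s3) = s1 + s2 + s3 := by
        change s2 + (s1 + s3) = _
        abel
      rw [this]
      exact hR
    · simp only [Multiset.map_cons, Multiset.sum_cons]
      change _ = m1 + m3 + (m2 + _)
      abel

lemma run_derives {s : Multiset (g.NT × Q × Q)} {τ : Multiset (ruleSet g E c)}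
    (h : Run (rInp g E c) (rOut g E c) s τ) : ∀ (α : List (Symbol A g.NT)) (p q : Q) (m0 : M),
    Ann E c α p q s m0 → ∃ u : List A, g.Derives α (u.map Symbol.terminal) ∧
      Ann (T := g.NT) E c (u.map Symbol.terminal) p q 0 (m0 + (τ.map (rWt g E c)).sum) := by
  induction h with
  | nil =>
    intro α p q m0 hA
    obtain ⟨u, rfl⟩ := ann_zero E c α p q m0 hA
    exact ⟨u, .refl _, by simpa using hA⟩
  | step ρ s τ _ ih =>
    intro α p q m0 hA
    obtain ⟨⟨⟨X, p1, p2⟩, ⟨s2, m2⟩⟩, r, hr, hX, hρ⟩ := ρ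
    simp only at hX hρ
    subst hX
    obtain ⟨α1, α2, s1, s3, m1, m3, rfl, rfl, rfl, h1, h3⟩ := ann_cons E c _ _ _ _ _ _ _ _ hA
    have : Ann E c (α1 ++ r.output ++ α2) p q (s2 + (s1 + s3)) (m1 + m2 + m3) := by
      rw [ann_append]
      refine ⟨p2, s1 + s2, s3, m1 + m2, m3, by abel, rfl, ?_, h3⟩
      rw [ann_append]
      exact ⟨p1, s1, s2, m1, m2, rfl, rfl, h1, hρ⟩
    obtain ⟨u, hu, hA'⟩ := ih _ _ _ _ this
    refine ⟨u, ?_, ?_⟩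
    · exact ContextFreeGrammar.Produces.trans_derives
        ⟨r, hr, r.rewrites_of_exists_parts α1 α2⟩ hu
    · convert hA' using 1
      simp only [Multiset.map_cons, Multiset.sum_cons]
      change m1 + m3 + (m2 + _) = _
      abel

/-- Weights of words of a context-free language along paths of a finite weighted automaton
form a semilinear set. -/
theorem semilinear_weights [Finite Q] (p q : Q) :
    IsSemilinearSet {m : M | ∃ u ∈ g.language,
      Ann (T := g.NT) E c (u.map Symbol.terminal) p q 0 m} := by
  have : Finite (ruleSet g E c) := ruleSet_finite g E c
  have h := (semilinear_run (inp := rInp g E c) (out := rOut g E c) {(g.initial, p, q)}).image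
    (Multiset.sumAddMonoidHom.comp (Multiset.mapAddMonoidHom (rWt g E c)))
  convert h using 1
  ext m
  simp only [Set.mem_ofPred_eq, Set.mem_image]
  constructor
  · rintro ⟨u, hu, hA⟩
    rw [ContextFreeGrammar.mem_language_iff] at hu
    obtain ⟨s, m0, τ, ⟨p', s', rfl, rfl, rfl, rfl⟩, hR, rfl⟩ := derives_run g E c hu hA
    exact ⟨τ, hR, by simp⟩
  · rintro ⟨τ, hR, rfl⟩
    obtain ⟨u, hu, hA⟩ := run_derives g E c hR [Symbol.nonterminal g.initial] p q 0
      ⟨q, 0, rfl, rfl, rfl, rfl⟩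
    exact ⟨u, hu, by simpa using hA⟩

end Annot

/-! ### The automaton for `w₁^* ⋯ w_n^*` -/

/-- The word `w₁^{m₁} ⋯ w_n^{m_n}`. -/
def G {A : Type} {n : ℕ} (w : Fin n → List A) (m : Fin n → ℕ) : List A :=
  (List.ofFn fun i => wpow (w i) (m i)).flatten

lemma wpow_zero {A : Type} (w : List A) : wpow w 0 = [] := by simp [wpow]

lemma wpow_one_add {A : Type} (w : List A) (k : ℕ) : wpow w (1 + k) = w ++ wpow w k := by
  rw [add_comm]; simp [wpow, List.replicate_succ]

lemma wpow_nil {A : Type} (k : ℕ) : wpow ([] : List A) k = [] := by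
  simp [wpow]

lemma G_succ {A : Type} {n : ℕ} (w : Fin (n + 1) → List A) (m : Fin (n + 1) → ℕ) :
    G w m = wpow (w 0) (m 0) ++ G (fun i => w i.succ) (fun i => m i.succ) := by
  simp [G, List.ofFn_succ]

lemma G_zero {A : Type} {n : ℕ} (w : Fin n → List A) : G w 0 = [] := by
  simp [G, wpow_zero]

lemma G_congr {A : Type} {n : ℕ} (w : Fin n → List A) (m m' : Fin n → ℕ)
    (h : ∀ k, w k ≠ [] → m k = m' k) : G w m = G w m' := by
  unfold G
  congr 2
  funext i
  by_cases hi : w i = []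
  · rw [hi, wpow_nil, wpow_nil]
  · rw [h i hi]

lemma G_single_add {A : Type} {n : ℕ} : ∀ (w : Fin n → List A) (m : Fin n → ℕ) (j : Fin n),
    (∀ k < j, m k = 0) → G w (Pi.single j 1 + m) = w j ++ G w m := by
  induction n with
  | zero => intro _ _ j; exact j.elim0
  | succ n ih =>
    intro w m j hj
    rw [G_succ, G_succ w m]
    induction j using Fin.cases with
    | zero =>
      have : (fun i : Fin n => (Pi.single (0 : Fin (n + 1)) 1 + m : Fin (n + 1) → ℕ) i.succ) =
          fun i => m i.succ := by
        funext i
        simp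
      rw [this]
      simp [wpow_one_add]
    | succ j =>
      have h0 : m 0 = 0 := hj 0 (Fin.succ_pos j)
      have : (fun i : Fin n => (Pi.single j.succ 1 + m : Fin (n + 1) → ℕ) i.succ) =
          Pi.single j 1 + fun i => m i.succ := by
        funext i
        simp [Pi.single_apply]
      rw [this, ih (fun i => w i.succ) (fun i => m i.succ) j
        (fun k hk => hj k.succ (Fin.succ_lt_succ_iff.2 hk))]
      simp [h0, wpow_zero, Pi.single_apply, (Fin.succ_ne_zero j).symm]

lemma exists_least {n : ℕ} (m : Fin n → ℕ) (hm : m ≠ 0) :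
    ∃ (j : Fin n) (m' : Fin n → ℕ), m = Pi.single j 1 + m' ∧ ∀ k < j, m k = 0 := by
  obtain ⟨i, hi⟩ := Function.ne_iff.1 hm
  obtain ⟨j, hj, hmin⟩ := WellFounded.has_min (wellFounded_lt (α := Fin n)) {i | m i ≠ 0} ⟨i, hi⟩
  refine ⟨j, m - Pi.single j 1, ?_, fun k hk => ?_⟩
  · funext k
    have hj' : m j ≠ 0 := hj
    by_cases hk : k = j
    · subst hk
      simp
      omega
    · simp [hk]
  · by_contra h
    exact hmin k h hk

section Auto

variable {A : Type} {n : ℕ} (w : Fin n → List A)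

/-- States: a lower bound for the next block, and the rest of the current block. -/
abbrev St (A : Type) (n L : ℕ) : Type := Fin (n + 1) × {v : List A // v.length ≤ L}

/-- Transitions. -/
def Ed (L : ℕ) (p : St A n L) (a : A) (q : St A n L) : Prop :=
  (p.2.1 = a :: q.2.1 ∧ q.1 = p.1) ∨
  (p.2.1 = [] ∧ ∃ j : Fin n, (p.1 : ℕ) ≤ j ∧ q.1 = j.castSucc ∧ w j = a :: q.2.1)

open Classical in
/-- Weights. -/
noncomputable def Wt (L : ℕ) (p q : St A n L) : Fin n → ℕ :=
  if p.2.1 = [] then fun k => if k.castSucc = q.1 then 1 else 0 else 0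

lemma Wt_cast {L : ℕ} {p q : St A n L} {j : Fin n} (hp : p.2.1 = []) (hq : q.1 = j.castSucc) :
    Wt L p q = Pi.single j 1 := by
  funext k
  simp [Wt, hp, hq, Pi.single_apply]

lemma path_sound {T : Type} {L : ℕ} (u : List A) : ∀ (p q : St A n L) (m : Fin n → ℕ),
    Ann (T := T) (Ed w L) (Wt L) (u.map Symbol.terminal) p q 0 m → q.2.1 = [] →
    u = p.2.1 ++ G w m ∧ ∀ k : Fin n, (k : ℕ) < p.1 → m k = 0 := by
  induction u with
  | nil =>
    rintro p q m ⟨rfl, _, rfl⟩ hq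
    simp [hq, G_zero]
  | cons a u ih =>
    rintro p q m ⟨p', m', hE, rfl, h⟩ hq
    obtain ⟨h1, h2⟩ := ih _ _ _ h hq
    rcases hE with ⟨hv, hi⟩ | ⟨hv, j, hj, hi, hw⟩
    · have : Wt L p p' = 0 := by simp [Wt, hv]
      rw [this, zero_add, hv, ← hi]
      exact ⟨by simp [← h1], h2⟩
    · rw [Wt_cast hv hi]
      have h3 : ∀ k < j, m' k = 0 := fun k hk => h2 k (by rw [hi]; exact hk)
      constructor
      · rw [G_single_add w m' j h3, hv, hw, h1]
        simp
      · intro k hk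
        have hkj : (k : ℕ) < j := lt_of_lt_of_le hk hj
        have hkj' : k ≠ j := by rintro rfl; omega
        simp [hkj', h3 k hkj]

lemma path_complete {T : Type} {L : ℕ} (hL : ∀ j, (w j).length ≤ L) (u : List A) :
    ∀ (p : St A n L) (m : Fin n → ℕ), u = p.2.1 ++ G w m →
    (∀ k : Fin n, (k : ℕ) < p.1 → m k = 0) → (∀ k, w k = [] → m k = 0) →
    ∃ q : St A n L, q.2.1 = [] ∧
      Ann (T := T) (Ed w L) (Wt L) (u.map Symbol.terminal) p q 0 m := by
  have least : ∀ m : Fin n → ℕ, (∀ k, w k = [] → m k = 0) → m ≠ 0 →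
      ∃ (j : Fin n) (m' : Fin n → ℕ) (b : A) (v : List A), m = Pi.single j 1 + m' ∧
        (∀ k < j, m k = 0) ∧ w j = b :: v ∧ G w m = b :: (v ++ G w m') ∧ m j ≠ 0 ∧
        (∀ k, m k = 0 → m' k = 0) := by
    intro m he hm
    obtain ⟨j, m', rfl, hj⟩ := exists_least m hm
    have hj' : ∀ k < j, m' k = 0 := fun k hk => by
      have := hj k hk
      simp at this
      exact this.2
    have hmj : (Pi.single j 1 + m' : Fin n → ℕ) j ≠ 0 := by simp
    obtain ⟨b, v, hbv⟩ := List.exists_cons_of_ne_nil (fun h => hmj (he j h))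
    refine ⟨j, m', b, v, rfl, hj, hbv, ?_, hmj, ?_⟩
    · rw [G_single_add w m' j hj', hbv]
      simp
    · intro k hk
      simp at hk
      exact hk.2
  induction u with
  | nil =>
    intro p m hu _ he
    have hu' := List.append_eq_nil_iff.1 hu.symm
    have hm : m = 0 := by
      by_contra hm
      obtain ⟨j, m', b, v, _, _, _, hG, _⟩ := least m he hm
      rw [hG] at hu'
      simp at hu'
    exact ⟨p, hu'.1, rfl, rfl, hm⟩
  | cons a u ih =>
    rintro ⟨i, v, hv⟩ m hu hs he
    cases v with
    | cons b v =>
      simp only [List.cons_append, List.cons.injEq] at hu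
      obtain ⟨rfl, hu⟩ := hu
      have hv' : v.length ≤ L := by simp at hv; omega
      obtain ⟨q, hq, hA⟩ := ih (i, ⟨v, hv'⟩) m hu hs he
      exact ⟨q, hq, (i, ⟨v, hv'⟩), m, .inl ⟨rfl, rfl⟩, by simp [Wt], hA⟩
    | nil =>
      have hm : m ≠ 0 := by
        rintro rfl
        simp [G_zero] at hu
      obtain ⟨j, m', b, v, hmm, hj, hw, hG, hmj, h0⟩ := least m he hm
      rw [hG] at hu
      simp only [List.nil_append, List.cons.injEq] at hu
      obtain ⟨rfl, hu⟩ := hu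
      have hv' : v.length ≤ L := by
        have := hL j
        rw [hw] at this
        simp at this; omega
      obtain ⟨q, hq, hA⟩ := ih (j.castSucc, ⟨v, hv'⟩) m' hu
        (fun k hk => h0 k (hj k hk)) (fun k hk => h0 k (he k hk))
      refine ⟨q, hq, (j.castSucc, ⟨v, hv'⟩), m', .inr ⟨rfl, j, ?_, rfl, hw⟩, ?_, hA⟩
      · by_contra h
        exact hmj (hs j (not_le.1 h))
      · rw [Wt_cast (j := j) rfl rfl, hmm]

end Auto

lemma isLinear_of {n : ℕ} {s : Set (Fin n → ℕ)} (h : IsLinearSet s) : IsLinear s := by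
  obtain ⟨a, k, f, rfl⟩ := isLinearSet_iff_exists_fin_addMonoidHom.1 h
  refine ⟨a, k, fun i => f (Pi.single i 1), ?_⟩
  have hf : ∀ x : Fin k → ℕ, f x = ∑ i, x i • f (Pi.single i 1) := by
    intro x
    conv_lhs => rw [pi_eq_sum_univ' x]
    rw [map_sum]
    refine Finset.sum_congr rfl fun i _ => ?_
    rw [map_nsmul]
  ext x
  simp only [Set.mem_vadd_set, Set.mem_range, Set.mem_ofPred_eq, vadd_eq_add]
  constructor
  · rintro ⟨_, ⟨y, rfl⟩, rfl⟩
    exact ⟨y, by rw [hf]⟩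
  · rintro ⟨y, rfl⟩
    exact ⟨_, ⟨y, rfl⟩, by rw [hf]⟩

lemma isSemilinear_of {n : ℕ} {s : Set (Fin n → ℕ)} (h : IsSemilinearSet s) : IsSemilinear s := by
  obtain ⟨S, hS, hlin, rfl⟩ := h
  have : Finite S := hS
  let e := Finite.equivFin S
  refine ⟨Nat.card S, fun i => (e.symm i).1, fun i => isLinear_of (hlin _ (e.symm i).2), ?_⟩
  rw [Set.sUnion_eq_iUnion]
  exact (e.symm.surjective.iUnion_comp (fun x : S => x.1)).symm

end PreimageCF

open PreimageCF in
/-- For context-free `K` and words `w₁, …, w_n`, the set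
`{m ∈ ℕⁿ : w₁^{m₁} ⋯ w_n^{m_n} ∈ K}` is semilinear. -/
theorem preimage_contextFree_semilinear {A : Type} [Fintype A] (K : Language A)
    (hK : K.IsContextFree) (n : ℕ) (w : Fin n → List A) :
    IsSemilinear {m : Fin n → ℕ |
      (List.ofFn fun i => wpow (w i) (m i)).flatten ∈ K} := by
  classical
  obtain ⟨g, rfl⟩ := hK
  apply isSemilinear_of
  let L := ∑ j, (w j).length
  have hL : ∀ j, (w j).length ≤ L := fun j =>
    Finset.single_le_sum (f := fun j => (w j).length) (fun _ _ => Nat.zero_le _)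
      (Finset.mem_univ j)
  have : Finite {v : List A // v.length ≤ L} := List.finite_length_le A L
  let p0 : St A n L := (0, ⟨[], Nat.zero_le _⟩)
  have hS : IsSemilinearSet (⋃ q ∈ {q : St A n L | q.2.1 = []},
      {m : Fin n → ℕ | ∃ u ∈ g.language,
        Ann (T := g.NT) (Ed w L) (Wt L) (u.map Symbol.terminal) p0 q 0 m}) :=
    .biUnion (Set.toFinite _) fun q _ => semilinear_weights g (Ed w L) (Wt L) p0 q
  let f : (Fin n → ℕ) →+ (Fin n → ℕ) :=
    { toFun := fun m k => if w k = [] then 0 else m k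
      map_zero' := by funext k; simp
      map_add' := by intro x y; funext k; by_cases h : w k = [] <;> simp [h] }
  convert hS.preimage f using 1
  ext m
  have hG : G w (f m) = G w m := G_congr w _ _ fun k hk => by simp [f, hk]
  simp only [Set.mem_ofPred_eq, Set.mem_preimage, Set.mem_iUnion, exists_prop]
  change G w m ∈ g.language ↔ _
  constructor
  · intro h
    obtain ⟨q, hq, hA⟩ := path_complete (T := g.NT) w hL (G w m) p0 (f m) (by simp [p0, hG])
      (by intro k hk; simp [p0] at hk) (by intro k hk; simp [f, hk])
    exact ⟨q, hq, _, h, hA⟩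
  · rintro ⟨q, hq, u, hu, hA⟩
    obtain ⟨h1, _⟩ := path_sound w u p0 q (f m) hA hq
    rw [hG] at h1
    simp only [p0, List.nil_append] at h1
    exact h1 ▸ hu
end

section
/- Let w₁,…,w_n ∈ Σ*, let L ⊆ w₁*w₂*⋯w_n* be context-free, and define g : ℕⁿ → Σ* by g(m) = w₁^{m₁}⋯w_n^{m_n}. Then there exists a semilinear set U ⊆ ℕⁿ such that g restricted to U is a bijection from U onto L. -/
open scoped Pointwise

namespace ParikhAux

/-- Regular functionals on families of subsets of a commutative monoid. -/
inductive Reg {V M : Type*} [AddCommMonoid M] : ((V → Set M) → Set M) → Prop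
  | const (s : Set M) (h : IsSemilinearSet s) : Reg (fun _ => s)
  | var (v : V) : Reg (fun ρ => ρ v)
  | union {f g : (V → Set M) → Set M} (hf : Reg f) (hg : Reg g) : Reg (fun ρ => f ρ ∪ g ρ)
  | add {f g : (V → Set M) → Set M} (hf : Reg f) (hg : Reg g) : Reg (fun ρ => f ρ + g ρ)
  | star {f : (V → Set M) → Set M} (hf : Reg f) :
      Reg (fun ρ => (AddSubmonoid.closure (f ρ) : Set M))

section
variable {V M : Type*} [AddCommMonoid M]

theorem Reg.mono {f : (V → Set M) → Set M} (hf : Reg f) : Monotone f := by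
  induction hf with
  | const s h => exact fun _ _ _ => le_rfl
  | var v => exact fun _ _ h => h v
  | union _ _ h1 h2 => exact fun _ _ h => Set.union_subset_union (h1 h) (h2 h)
  | add _ _ h1 h2 => exact fun _ _ h => Set.add_subset_add (h1 h) (h2 h)
  | star _ h1 => exact fun _ _ h => AddSubmonoid.closure_mono (h1 h)

theorem Reg.subst {f : (V → Set M) → Set M} (hf : Reg f) {G : V → (V → Set M) → Set M}
    (hG : ∀ v, Reg (G v)) : Reg (fun ρ => f (fun v => G v ρ)) := by
  induction hf with
  | const s h => exact .const s h
  | var v => exact hG v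
  | union _ _ h1 h2 => exact h1.union h2
  | add _ _ h1 h2 => exact h1.add h2
  | star _ h1 => exact h1.star

theorem Reg.semilinear {f : (V → Set M) → Set M} (hf : Reg f) {ρ : V → Set M}
    (hρ : ∀ v, IsSemilinearSet (ρ v)) : IsSemilinearSet (f ρ) := by
  induction hf with
  | const s h => exact h
  | var v => exact hρ v
  | union _ _ h1 h2 => exact h1.union h2
  | add _ _ h1 h2 => exact h1.add h2
  | star _ h1 => exact h1.closure

theorem Reg.empty : Reg (fun _ : V → Set M => (∅ : Set M)) := .const _ .empty

theorem Reg.biUnion {ι : Type*} (s : Finset ι) {f : ι → (V → Set M) → Set M}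
    (hf : ∀ i, Reg (f i)) : Reg (fun ρ => ⋃ i ∈ s, f i ρ) := by
  classical
  induction s using Finset.induction_on with
  | empty => simpa using Reg.empty
  | insert a s ha ih =>
    simp only [Finset.set_biUnion_insert]
    exact (hf a).union ih

theorem Reg.iUnion {ι : Type*} [Finite ι] {f : ι → (V → Set M) → Set M}
    (hf : ∀ i, Reg (f i)) : Reg (fun ρ => ⋃ i, f i ρ) := by
  have := Fintype.ofFinite ι
  simpa using Reg.biUnion Finset.univ hf

variable [DecidableEq V]

theorem Reg.update {f h : (V → Set M) → Set M} (hf : Reg f) (hh : Reg h) (x : V) :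
    Reg (fun ρ => f (Function.update ρ x (h ρ))) := by
  have : Reg (fun ρ => f (fun v => (if v = x then h else fun ρ => ρ v) ρ)) := by
    apply hf.subst
    intro v
    split_ifs
    · exact hh
    · exact .var v
  convert this using 3 with ρ
  ext1 v
  by_cases hv : v = x
  · subst hv; simp
  · simp [hv]

theorem Reg.decomp {f : (V → Set M) → Set M} (hf : Reg f) (x : V) :
    ∃ g, Reg g ∧ ∀ ρ, f ρ = f (Function.update ρ x ∅) ∪ (g ρ + ρ x) := by
  induction hf with
  | const s h => exact ⟨_, .empty, by simp⟩
  | var v =>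
    by_cases hv : v = x
    · subst hv
      exact ⟨_, .const {0} (by simp), by simp⟩
    · exact ⟨_, .empty, by simp [hv]⟩
  | union hf1 hf2 h1 h2 =>
    obtain ⟨g1, hg1, h1⟩ := h1
    obtain ⟨g2, hg2, h2⟩ := h2
    refine ⟨_, hg1.union hg2, fun ρ => ?_⟩
    dsimp only
    rw [Set.union_add, h1 ρ, h2 ρ]
    ac_rfl
  | @add f1 f2 hf1 hf2 h1 h2 =>
    obtain ⟨g1, hg1, h1⟩ := h1
    obtain ⟨g2, hg2, h2⟩ := h2
    refine ⟨_, (hg1.add hf2).union ((hf1.update .empty x).add hg2), fun ρ => ?_⟩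
    dsimp only
    conv_lhs => rw [h1 ρ, Set.union_add]
    conv_lhs => 
      left
      rw [h2 ρ, Set.add_union]
    rw [Set.union_add, Set.union_assoc, add_right_comm (g1 ρ), add_assoc _ (g2 ρ),
      Set.union_comm (g1 ρ + f2 ρ + ρ x)]
  | @star f hf h1 =>
    obtain ⟨g, hg, h1⟩ := h1
    refine ⟨_, hf.star.add hg, fun ρ => ?_⟩
    apply Set.Subset.antisymm
    · intro y hy
      induction hy using AddSubmonoid.closure_induction with
      | mem y hy =>
        rw [h1 ρ] at hy
        rcases hy with hy | hy
        · exact .inl (AddSubmonoid.subset_closure hy)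
        · right
          rw [add_assoc]
          exact ⟨0, zero_mem _, y, hy, by simp⟩
      | zero => exact .inl (zero_mem _)
      | add y z hy hz h2 h3 =>
        rcases h2 with h2 | ⟨b, ⟨k, hk, c, hc, rfl⟩, d, hd, rfl⟩
        · rcases h3 with h3 | ⟨b, ⟨k, hk, c, hc, rfl⟩, d, hd, rfl⟩
          · exact .inl (add_mem h2 h3)
          · exact .inr ⟨_, ⟨y + k, add_mem hy hk, c, hc, rfl⟩, d, hd, by simp only [add_assoc]⟩
        · exact .inr ⟨_, ⟨k + z, add_mem hk hz, c, hc, rfl⟩, d, hd, by simp only []; abel⟩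
    · have hm : f (Function.update ρ x ∅) ⊆ f ρ := by
        rw [h1 ρ]; exact Set.subset_union_left
      rintro y (hy | ⟨b, ⟨k, hk, c, hc, rfl⟩, d, hd, rfl⟩)
      · exact AddSubmonoid.closure_mono hm hy
      · simp only [add_assoc]
        refine add_mem hk (AddSubmonoid.subset_closure ?_)
        rw [h1 ρ]
        exact .inr ⟨c, hc, d, hd, rfl⟩

theorem Reg.pump {f : (V → Set M) → Set M} (hf : Reg f) (x : V) (C : AddSubmonoid M)
    (ρ : V → Set M) (s : Set M) :
    f (Function.update ρ x (C + s)) + C ⊆ f (Function.update ρ x s) + C := by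
  have hC : (C : Set M) + C = C := by
    apply Set.Subset.antisymm
    · rintro _ ⟨a, ha, b, hb, rfl⟩
      exact add_mem ha hb
    · intro a ha
      exact ⟨a, ha, 0, zero_mem _, by simp⟩
  induction hf with
  | const s h => exact le_rfl
  | var v =>
    by_cases hv : v = x
    · subst hv
      simp only [Function.update_self]
      rw [add_comm (C : Set M), add_assoc, hC]
    · simp [hv]
  | union hf1 hf2 h1 h2 =>
    simp only [Set.union_add]
    exact Set.union_subset_union h1 h2
  | @add f1 f2 hf1 hf2 h1 h2 =>
    have := Set.add_subset_add h1 h2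
    rwa [add_add_add_comm, add_add_add_comm (f1 (Function.update ρ x s)), hC] at this
  | @star f hf h1 =>
    rintro _ ⟨y, hy, c, hc, rfl⟩
    simp only
    induction hy using AddSubmonoid.closure_induction generalizing c with
    | mem y hy =>
      obtain ⟨z, hz, d, hd, h⟩ := h1 ⟨y, hy, c, hc, rfl⟩
      exact ⟨z, AddSubmonoid.subset_closure hz, d, hd, h⟩
    | zero => exact ⟨0, zero_mem _, c, hc, rfl⟩
    | add y z hy hz h2 h3 =>
      obtain ⟨y', hy', d, hd, h⟩ := h2 c hc
      obtain ⟨z', hz', e, he, h'⟩ := h3 d hd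
      refine ⟨y' + z', add_mem hy' hz', e, he, ?_⟩
      simp only at h h' ⊢
      rw [add_assoc, h', add_right_comm, ← h]
      abel

theorem Reg.fix {f : (V → Set M) → Set M} (hf : Reg f) (x : V) :
    ∃ h, Reg h ∧ (∀ ρ, f (Function.update ρ x (h ρ)) ⊆ h ρ) ∧
      (∀ τ, f τ ⊆ τ x → h τ ⊆ τ x) := by
  obtain ⟨g, hg, hd⟩ := hf.decomp x
  have ha := hf.update Reg.empty x
  have hc := hg.update ha x
  refine ⟨_, hc.star.add ha, fun ρ => ?_, fun τ hτ => ?_⟩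
  · rw [hd, Function.update_idem, Function.update_self]
    set a := f (Function.update ρ x ∅)
    set c := g (Function.update ρ x a) with hcd
    refine Set.union_subset ?_ ?_
    · intro y hy
      exact ⟨0, zero_mem _, y, hy, by simp⟩
    · have := hg.pump x (AddSubmonoid.closure c) ρ a
      rw [← hcd] at this
      rw [← add_assoc]
      refine Set.add_subset_add (this.trans ?_) le_rfl
      rintro _ ⟨y, hy, z, hz, rfl⟩
      exact add_mem (AddSubmonoid.subset_closure hy) hz
  · have h0 : f (Function.update τ x ∅) ⊆ τ x :=
      (hf.mono (update_le_self_iff.2 (Set.empty_subset _))).trans hτ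
    rintro _ ⟨y, hy, z, hz, rfl⟩
    replace hz := h0 hz
    simp only
    induction hy using AddSubmonoid.closure_induction generalizing z with
    | mem y hy =>
      apply hτ
      rw [hd]
      exact .inr ⟨y, hg.mono (update_le_self_iff.2 h0) hy, z, hz, rfl⟩
    | zero => simpa
    | add y y' _ _ h2 h3 =>
      rw [add_assoc]
      exact h2 _ (h3 _ hz)

/-- Elimination of finitely many variables. -/
theorem exists_solution (F : V → (V → Set M) → Set M) (hF : ∀ v, Reg (F v)) (s : Finset V) :
    ∃ G : V → (V → Set M) → Set M, (∀ v, Reg (G v)) ∧ (∀ v ∉ s, ∀ ρ, G v ρ = ρ v) ∧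
      (∀ ρ, ∀ v ∈ s, F v (fun u => G u ρ) ⊆ G v ρ) ∧
      (∀ τ, (∀ v ∈ s, F v τ ⊆ τ v) → ∀ v, G v τ ⊆ τ v) := by
  induction s using Finset.induction_on with
  | empty => exact ⟨fun v ρ => ρ v, fun v => .var v, by simp, by simp, by simp⟩
  | insert x s hx ih =>
    obtain ⟨G, hG, h1, h2, h3⟩ := ih
    obtain ⟨h, hh, h4, h5⟩ := ((hF x).subst hG).fix x
    refine ⟨fun v ρ => G v (Function.update ρ x (h ρ)), fun v => (hG v).update hh x, ?_, ?_, ?_⟩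
    · intro v hv ρ
      rw [Finset.mem_insert, not_or] at hv
      dsimp only
      rw [h1 v hv.2, Function.update_of_ne hv.1]
    · intro ρ v hv
      rw [Finset.mem_insert] at hv
      rcases hv with rfl | hv
      · dsimp only
        rw [h1 v hx, Function.update_self]
        exact h4 ρ
      · exact h2 _ v hv
    · intro τ hτ v
      have h6 := h3 τ (fun v hv => hτ v (Finset.mem_insert_of_mem hv))
      have h7 : h τ ⊆ τ x :=
        h5 τ (((hF x).mono h6).trans (hτ x (Finset.mem_insert_self _ _)))
      exact ((hG v).mono (update_le_self_iff.2 h7)).trans (h6 v)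

/-- The least solution of a finite regular system is semilinear. -/
theorem exists_least_semilinear (F : V → (V → Set M) → Set M) (hF : ∀ v, Reg (F v))
    (s : Finset V) :
    ∃ σ : V → Set M, (∀ v, IsSemilinearSet (σ v)) ∧ (∀ v ∈ s, F v σ ⊆ σ v) ∧
      (∀ τ : V → Set M, (∀ v ∈ s, F v τ ⊆ τ v) → ∀ v, σ v ⊆ τ v) := by
  obtain ⟨G, hG, -, h2, h3⟩ := exists_solution F hF s
  refine ⟨fun v => G v (fun _ => ∅), fun v => (hG v).semilinear (by simp), h2 _, ?_⟩
  intro τ hτ v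
  exact ((hG v).mono (fun _ => Set.empty_subset _)).trans (h3 τ hτ v)

end

section
variable {Q α M : Type*} [AddCommMonoid M]

/-- Weights of the runs of a weighted automaton on a word. -/
def path (W : Q → α → Q → Set M) : List α → Q → Q → Set M
  | [], p, q => {v | p = q ∧ v = 0}
  | a :: x, p, q => ⋃ r, W p a r + path W x r q

theorem mem_path_nil {W : Q → α → Q → Set M} {p q : Q} {v : M} :
    v ∈ path W [] p q ↔ p = q ∧ v = 0 := Iff.rfl

theorem mem_path_cons {W : Q → α → Q → Set M} {a : α} {x : List α} {p q : Q} {v : M} :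
    v ∈ path W (a :: x) p q ↔ ∃ r, ∃ u ∈ W p a r, ∃ u' ∈ path W x r q, u + u' = v := by
  simp [path, Set.mem_add]

theorem mem_path_append {W : Q → α → Q → Set M} {x y : List α} {p q : Q} {v : M} :
    v ∈ path W (x ++ y) p q ↔
      ∃ r, ∃ u ∈ path W x p r, ∃ u' ∈ path W y r q, u + u' = v := by
  induction x generalizing p v with
  | nil => simp [mem_path_nil]
  | cons a x ih =>
    simp only [List.cons_append, mem_path_cons, ih]
    constructor
    · rintro ⟨r, u, hu, u', ⟨r', u1, hu1, u2, hu2, rfl⟩, rfl⟩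
      exact ⟨r', _, ⟨r, u, hu, u1, hu1, rfl⟩, u2, hu2, add_assoc _ _ _⟩
    · rintro ⟨r', _, ⟨r, u, hu, u1, hu1, rfl⟩, u2, hu2, rfl⟩
      exact ⟨r, u, hu, _, ⟨r', u1, hu1, u2, hu2, rfl⟩, (add_assoc _ _ _).symm⟩

/-- Weights of symbols: terminals use the automaton, nonterminals the given family. -/
def symW {T N : Type*} (W : Q → T → Q → Set M) (ρ : Q × N × Q → Set M) :
    Q → Symbol T N → Q → Set M
  | p, .terminal t, q => W p t q
  | p, .nonterminal A, q => ρ (p, A, q)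

theorem path_map_terminal {T N : Type*} (W : Q → T → Q → Set M) (ρ : Q × N × Q → Set M)
    (x : List T) (p q : Q) :
    path (symW W ρ) (x.map Symbol.terminal) p q = path W x p q := by
  induction x generalizing p with
  | nil => rfl
  | cons a x ih => simp [path, ih, symW]

theorem reg_path {T N : Type*} [Finite Q] (W : Q → T → Q → Set M)
    (hW : ∀ p t q, IsSemilinearSet (W p t q)) (u : List (Symbol T N)) (p q : Q) :
    Reg (fun ρ : Q × N × Q → Set M => path (symW W ρ) u p q) := by
  induction u generalizing p with
  | nil =>
    exact .const _ (.of_finite (Set.Finite.subset (Set.finite_singleton 0) fun v hv => hv.2))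
  | cons a u ih =>
    refine Reg.iUnion fun r => Reg.add ?_ (ih r)
    cases a with
    | terminal t => exact .const _ (hW p t r)
    | nonterminal A => exact .var (p, A, r)

/-- Parikh's theorem for a context-free language read by a weighted automaton. -/
theorem semilinear_of_contextFree {T : Type*} [Finite Q] (W : Q → T → Q → Set M)
    (hW : ∀ p t q, IsSemilinearSet (W p t q)) (L : Language T) (hL : L.IsContextFree)
    (p q : Q) : IsSemilinearSet {v | ∃ x ∈ L, v ∈ path W x p q} := by
  classical
  have := Fintype.ofFinite Q
  obtain ⟨g, rfl⟩ := hL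
  let F : Q × g.NT × Q → (Q × g.NT × Q → Set M) → Set M := fun v ρ =>
    ⋃ r ∈ g.rules.filter (fun r => r.input = v.2.1), path (symW W ρ) r.output v.1 v.2.2
  have hF : ∀ v, Reg (F v) := fun v => Reg.biUnion _ fun r => reg_path W hW r.output _ _
  obtain ⟨σ, h1, h2, h3⟩ := exists_least_semilinear F hF
    (Finset.univ ×ˢ ((g.rules.image fun r => r.input) ×ˢ Finset.univ))
  convert h1 (p, g.initial, q) using 1
  have hprod : ∀ r ∈ g.rules, ∀ u u', r.Rewrites u u' → ∀ p q,
      path (symW W σ) u' p q ⊆ path (symW W σ) u p q := by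
    intro r hr u u' h
    induction h with
    | head s =>
      intro p q v hv
      obtain ⟨r', u, hu, u', hu', rfl⟩ := mem_path_append.1 hv
      refine mem_path_cons.2 ⟨r', u, ?_, u', hu', rfl⟩
      refine h2 (p, r.input, r') ?_ ?_
      · simp only [Finset.mem_product, Finset.mem_univ, true_and, and_true]
        exact Finset.mem_image_of_mem _ hr
      · simp only [F, Set.mem_iUnion]
        exact ⟨r, by simp [hr], hu⟩
    | cons x h ih =>
      intro p q v hv
      obtain ⟨r', u, hu, u', hu', rfl⟩ := mem_path_cons.1 hv
      exact mem_path_cons.2 ⟨r', u, hu, u', ih _ _ hu', rfl⟩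
  apply Set.Subset.antisymm
  · rintro v ⟨x, hx, hv⟩
    have hx' : g.Derives [.nonterminal g.initial] (x.map Symbol.terminal) := hx
    rw [← path_map_terminal W σ] at hv
    have key : v ∈ path (symW W σ) [.nonterminal g.initial] p q := by
      clear hx
      revert hx'
      generalize [Symbol.nonterminal g.initial] = u
      intro hx'
      induction hx' using Relation.ReflTransGen.head_induction_on with
      | refl => exact hv
      | head h _ ih =>
        obtain ⟨r, hr, h⟩ := h
        exact hprod r hr _ _ h _ _ ih
    simpa [mem_path_cons, mem_path_nil, symW] using key
  · refine h3 (fun a => {v | ∃ x : List T, g.Derives [.nonterminal a.2.1] (x.map Symbol.terminal) ∧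
      v ∈ path W x a.1 a.2.2}) ?_ (p, g.initial, q)
    rintro ⟨p, A, q⟩ - v hv
    simp only [F, Set.mem_iUnion, Finset.mem_filter] at hv
    obtain ⟨r, ⟨hr, rfl⟩, hv⟩ := hv
    have key : ∀ (u : List (Symbol T g.NT)) (p q : Q) (v : M), v ∈ path (symW W
        (fun a => {v | ∃ x : List T, g.Derives [.nonterminal a.2.1] (x.map Symbol.terminal) ∧
          v ∈ path W x a.1 a.2.2})) u p q →
        ∃ x : List T, g.Derives u (x.map Symbol.terminal) ∧ v ∈ path W x p q := by
      intro u
      induction u with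
      | nil => exact fun p q v hv => ⟨[], Relation.ReflTransGen.refl, hv⟩
      | cons a u ih =>
        intro p q v hv
        obtain ⟨r', v1, hv1, v2, hv2, rfl⟩ := mem_path_cons.1 hv
        obtain ⟨y, hy, hy'⟩ := ih _ _ _ hv2
        cases a with
        | terminal t =>
          exact ⟨t :: y, hy.append_left [.terminal t],
            mem_path_cons.2 ⟨r', v1, hv1, v2, hy', rfl⟩⟩
        | nonterminal A =>
          obtain ⟨x, hx, hx'⟩ := hv1
          refine ⟨x ++ y, ?_, mem_path_append.2 ⟨r', v1, hx', v2, hy', rfl⟩⟩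
          rw [List.map_append]
          exact (hx.append_right u).trans (hy.append_left _)
    obtain ⟨x, hx, hx'⟩ := key _ _ _ _ hv
    refine ⟨x, ?_, hx'⟩
    exact (ContextFreeGrammar.Produces.single ⟨r, hr, .input_output⟩).trans hx

/-- Product of two weighted automata. -/
theorem mem_path_prod {ι : Type*} (W : Q → α → Q → Set (ι → ℕ)) (x : List α) (p p' q q' : Q)
    (v : ι → ℕ) (v' : ι → ℕ) :
    Sum.elim v v' ∈ path (fun (a : Q × Q) t (b : Q × Q) =>
      Set.image2 Sum.elim (W a.1 t b.1) (W a.2 t b.2)) x (p, p') (q, q') ↔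
    v ∈ path W x p q ∧ v' ∈ path W x p' q' := by
  have hadd : ∀ a b c d : ι → ℕ, Sum.elim a b + Sum.elim c d = Sum.elim (a + c) (b + d) := by
    intro a b c d
    ext i
    cases i <;> rfl
  have hinj : ∀ a b c d : ι → ℕ, Sum.elim a b = Sum.elim c d ↔ a = c ∧ b = d := by
    intro a b c d
    constructor
    · intro h
      exact ⟨funext fun i => congrFun h (.inl i), funext fun i => congrFun h (.inr i)⟩
    · rintro ⟨rfl, rfl⟩; rfl
  have h0 : (0 : ι ⊕ ι → ℕ) = Sum.elim (0 : ι → ℕ) (0 : ι → ℕ) := by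
    ext i
    cases i <;> rfl
  induction x generalizing p p' v v' with
  | nil =>
    rw [mem_path_nil, mem_path_nil, mem_path_nil, h0, hinj, Prod.mk.injEq]
    tauto
  | cons a x ih =>
    simp only [mem_path_cons]
    constructor
    · rintro ⟨⟨r, r'⟩, _, ⟨u, hu, u', hu', rfl⟩, z, hz, h⟩
      obtain ⟨z1, z2, rfl⟩ : ∃ z1 z2, z = Sum.elim z1 z2 :=
        ⟨_, _, (Sum.elim_comp_inl_inr z).symm⟩
      rw [hadd, hinj] at h
      obtain ⟨rfl, rfl⟩ := h
      obtain ⟨hz1, hz2⟩ := (ih _ _ _ _).1 hz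
      exact ⟨⟨r, u, hu, z1, hz1, rfl⟩, ⟨r', u', hu', z2, hz2, rfl⟩⟩
    · rintro ⟨⟨r, u, hu, z1, hz1, rfl⟩, ⟨r', u', hu', z2, hz2, rfl⟩⟩
      exact ⟨(r, r'), _, ⟨u, hu, u', hu', rfl⟩, _, (ih _ _ _ _).2 ⟨hz1, hz2⟩, hadd _ _ _ _⟩

end

section
variable {A : Type} {n : ℕ}

/-- The word map. -/
def gw {n : ℕ} (w : Fin n → List A) (m : Fin n → ℕ) : List A :=
  (List.ofFn fun i => wpow (w i) (m i)).flatten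

theorem wpow_zero (w : List A) : wpow w 0 = [] := by simp [wpow]

theorem wpow_one_add (w : List A) (k : ℕ) : wpow w (1 + k) = w ++ wpow w k := by
  simp [wpow, Nat.add_comm 1, List.replicate_succ]

theorem gw_zero (w : Fin n → List A) : gw w 0 = [] := by
  simp [gw, wpow]

theorem gw_succ (w : Fin (n + 1) → List A) (m : Fin (n + 1) → ℕ) :
    gw w m = wpow (w 0) (m 0) ++ gw (fun i => w i.succ) (fun i => m i.succ) := by
  simp [gw, List.ofFn_succ]

theorem gw_single_add (w : Fin n → List A) (m : Fin n → ℕ) (k : Fin n)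
    (hm : ∀ i < k, m i = 0) : gw w (Pi.single k 1 + m) = w k ++ gw w m := by
  induction n with
  | zero => exact k.elim0
  | succ n ih =>
    rw [gw_succ, gw_succ]
    induction k using Fin.cases with
    | zero =>
      simp only [Pi.add_apply, Pi.single_eq_same, wpow_one_add, List.append_assoc]
      congr 3
      ext i
      simp
    | succ k =>
      have h0 : m 0 = 0 := hm 0 (Fin.succ_pos k)
      have := ih (fun i => w i.succ) (fun i => m i.succ) k
        (fun i hi => hm _ (Fin.succ_lt_succ_iff.2 hi))
      simp only [Pi.add_apply, h0, wpow_zero, List.nil_append,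
        Pi.single_eq_of_ne (Fin.succ_ne_zero k).symm, add_zero]
      rw [← this]
      congr 1
      ext i
      simp [Pi.single_apply]

/-- States: a lower bound for the next index, and the rest of the current block. -/
abbrev St (A : Type) (n B : ℕ) : Type := Fin (n + 1) × {r : List A // r.length ≤ B}

/-- The weighted automaton that splits a word into blocks. -/
def aut (w : Fin n → List A) (B : ℕ) (p : St A n B) (t : A) (q : St A n B) : Set (Fin n → ℕ) :=
  {v | (p.1 = q.1 ∧ p.2.1 = t :: q.2.1 ∧ v = 0) ∨
    ∃ k : Fin n, p.2.1 = [] ∧ p.1 ≤ k.castSucc ∧ q.1 = k.castSucc ∧ w k = t :: q.2.1 ∧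
      v = Pi.single k 1}

theorem aut_finite (w : Fin n → List A) (B : ℕ) (p : St A n B) (t : A) (q : St A n B) :
    (aut w B p t q).Finite := by
  refine ((Set.finite_singleton 0).union
    (Set.finite_range fun k : Fin n => (Pi.single k 1 : Fin n → ℕ))).subset ?_
  rintro v (⟨-, -, rfl⟩ | ⟨k, -, -, -, -, rfl⟩)
  · exact .inl rfl
  · exact .inr ⟨k, rfl⟩

theorem aut_sound (w : Fin n → List A) (B : ℕ) (x : List A) (p q : St A n B) (v : Fin n → ℕ)
    (hq : q.2.1 = []) (hv : v ∈ path (aut w B) x p q) :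
    x = p.2.1 ++ gw w v ∧ ∀ i : Fin n, i.castSucc < p.1 → v i = 0 := by
  induction x generalizing p v with
  | nil =>
    obtain ⟨rfl, rfl⟩ := mem_path_nil.1 hv
    simp [hq, gw_zero]
  | cons t x ih =>
    obtain ⟨r, u, hu, u', hu', rfl⟩ := mem_path_cons.1 hv
    obtain ⟨h1, h2⟩ := ih r u' hu'
    rcases hu with ⟨h3, h4, rfl⟩ | ⟨k, h3, h4, h5, h6, rfl⟩
    · simp only [zero_add, h4, h3]
      exact ⟨by simp [h1], h2⟩
    · have h7 : ∀ i < k, u' i = 0 := fun i hi => h2 i (by rw [h5]; exact hi)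
      rw [gw_single_add w u' k h7, h3, h6, h1]
      refine ⟨by simp, fun i hi => ?_⟩
      have hik : i < k := Fin.castSucc_lt_castSucc_iff.1 (lt_of_lt_of_le hi h4)
      simp [h7 i hik, Pi.single_eq_of_ne hik.ne]

theorem aut_complete (w : Fin n → List A) (B : ℕ) (hB : ∀ i, (w i).length ≤ B) (N : ℕ) :
    ∀ (m : Fin n → ℕ), ∑ i, m i = N → ∀ (r : List A) (hr : r.length ≤ B) (l : Fin (n + 1)),
      (∀ i : Fin n, i.castSucc < l → m i = 0) →
      ∃ (v : Fin n → ℕ) (q : St A n B), q.2.1 = [] ∧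
        v ∈ path (aut w B) (r ++ gw w m) (l, ⟨r, hr⟩) q := by
  induction N with
  | zero =>
    intro m hm r
    have hm0 : m = 0 := by
      ext i
      have := Finset.sum_eq_zero_iff.1 hm i (Finset.mem_univ _)
      simpa using this
    subst hm0
    induction r with
    | nil =>
      intro hr l hl
      exact ⟨0, (l, ⟨[], hr⟩), rfl, by simp [gw_zero, mem_path_nil]⟩
    | cons t r ih =>
      intro hr l hl
      have hr' : r.length ≤ B := by simp at hr; omega
      obtain ⟨v, q, hq, h⟩ := ih hr' l hl
      exact ⟨v, q, hq, mem_path_cons.2 ⟨(l, ⟨r, hr'⟩), 0, .inl ⟨rfl, rfl, rfl⟩, v, h, by simp⟩⟩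
  | succ N IH =>
    intro m hm r
    induction r with
    | cons t r ih =>
      intro hr l hl
      have hr' : r.length ≤ B := by simp at hr; omega
      obtain ⟨v, q, hq, h⟩ := ih hr' l hl
      exact ⟨v, q, hq, mem_path_cons.2 ⟨(l, ⟨r, hr'⟩), 0, .inl ⟨rfl, rfl, rfl⟩, v, h, by simp⟩⟩
    | nil =>
      intro hr l hl
      have hex : ∃ k, m k ≠ 0 := by
        by_contra! hcon
        simp [hcon] at hm
      obtain ⟨k, hk, hmin⟩ := WellFounded.has_min (wellFounded_lt (α := Fin n)) {k | m k ≠ 0} hex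
      have hmin' : ∀ i < k, m i = 0 := fun i hi => by
        by_contra hne
        exact hmin i hne hi
      obtain ⟨m', rfl⟩ : ∃ m' : Fin n → ℕ, m = Pi.single k 1 + m' := by
        refine ⟨m - Pi.single k 1, ?_⟩
        ext i
        by_cases hi : i = k
        · subst hi
          have hk' : m i ≠ 0 := hk
          change m i = (Pi.single i 1 : Fin n → ℕ) i + (m i - (Pi.single i 1 : Fin n → ℕ) i)
          rw [Pi.single_eq_same]
          omega
        · change m i = (Pi.single k 1 : Fin n → ℕ) i + (m i - (Pi.single k 1 : Fin n → ℕ) i)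
          rw [Pi.single_eq_of_ne hi]
          omega
      have hs : ∑ i, m' i = N := by
        have h1 : ∑ i, (Pi.single k 1 : Fin n → ℕ) i = 1 := by simp
        simp only [Pi.add_apply, Finset.sum_add_distrib, h1] at hm
        omega
      have hm' : ∀ i < k, m' i = 0 := fun i hi => by
        have := hmin' i hi
        rw [Pi.add_apply] at this
        omega
      rw [gw_single_add w m' k hm']
      have hlk : l ≤ k.castSucc := by
        by_contra! hlt
        exact hk (hl k hlt)
      cases hw : w k with
      | nil =>
        obtain ⟨v, q, hq, h⟩ := IH m' hs [] hr l (fun i hi => hm' i (Fin.castSucc_lt_castSucc_iff.1 (lt_of_lt_of_le hi hlk)))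
        exact ⟨v, q, hq, by simpa using h⟩
      | cons t r =>
        have hr' : r.length ≤ B := by
          have := hB k
          rw [hw] at this
          simp at this
          omega
        obtain ⟨v, q, hq, h⟩ := IH m' hs r hr' k.castSucc (fun i hi => hm' i hi)
        exact ⟨_, q, hq, mem_path_cons.2 ⟨(k.castSucc, ⟨r, hr'⟩), Pi.single k 1,
          .inr ⟨k, rfl, hlk, rfl, hw, rfl⟩, v, h, rfl⟩⟩

theorem semilinear_lex (n : ℕ) : IsSemilinearSet {y : Fin n ⊕ Fin n → ℕ |
    ∃ i, (∀ j < i, y (.inr j) = y (.inl j)) ∧ y (.inr i) < y (.inl i)} := by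
  have hlt : IsSemilinearSet {z : ℕ × ℕ | z.1 < z.2} := by
    have := ((IsSemilinearSet.univ (M := ℕ × ℕ)).image
      ((AddMonoidHom.fst ℕ ℕ).prod (AddMonoidHom.fst ℕ ℕ + AddMonoidHom.snd ℕ ℕ))).vadd
      ((0, 1) : ℕ × ℕ)
    convert this using 1
    ext ⟨a, b⟩
    simp only [Set.mem_ofPred_eq, Set.mem_vadd_set, Set.image_univ, Set.mem_range]
    constructor
    · intro h
      exact ⟨_, ⟨(a, b - a - 1), rfl⟩, by ext <;> simp; omega⟩
    · rintro ⟨_, ⟨⟨c, d⟩, rfl⟩, h⟩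
      simp at h
      omega
  have hset : {y : Fin n ⊕ Fin n → ℕ |
      ∃ i, (∀ j < i, y (.inr j) = y (.inl j)) ∧ y (.inr i) < y (.inl i)} =
      ⋃ i : Fin n, ({y | 0 + (LinearMap.funLeft ℕ ℕ (fun j : {j // j < i} => Sum.inr j.1)) y
        = 0 + (LinearMap.funLeft ℕ ℕ (fun j : {j // j < i} => Sum.inl j.1)) y} ∩
        (((Pi.evalAddMonoidHom (fun _ : Fin n ⊕ Fin n => ℕ) (.inr i)).prod
          (Pi.evalAddMonoidHom (fun _ : Fin n ⊕ Fin n => ℕ) (.inl i))) ⁻¹' {z | z.1 < z.2})) := by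
    ext y
    simp [funext_iff, LinearMap.funLeft_apply]
  rw [hset]
  exact .iUnion fun i => (isSemilinearSet_setOfPred_eq _ _ _ _).inter (hlt.preimage _)

theorem isSemilinear_of {M : Type*} [AddCommMonoid M] {s : Set M} (hs : IsSemilinearSet s) :
    IsSemilinear s := by
  obtain ⟨S, hS, hS', rfl⟩ := hs
  have := hS.to_subtype
  obtain ⟨m, ⟨f⟩⟩ := Finite.exists_equiv_fin S
  refine ⟨m, fun i => (f.symm i).1, fun i => ?_, ?_⟩
  · obtain ⟨a, k, φ, h⟩ := isLinearSet_iff_exists_fin_addMonoidHom.1 (hS' _ (f.symm i).2)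
    refine ⟨a, k, fun i => φ (Pi.single i 1), ?_⟩
    dsimp only
    rw [h]
    have hφ : ∀ c, φ c = ∑ i, c i • φ (Pi.single i 1) := by
      intro c
      conv_lhs => rw [← Finset.univ_sum_single c]
      rw [map_sum]
      refine Finset.sum_congr rfl fun i _ => ?_
      rw [← map_nsmul]
      congr 1
      ext j
      by_cases hj : j = i
      · subst hj; simp
      · simp [hj]
    ext x
    simp only [Set.mem_vadd_set, Set.mem_range, Set.mem_ofPred_eq, vadd_eq_add]
    constructor
    · rintro ⟨_, ⟨c, rfl⟩, rfl⟩
      exact ⟨c, by rw [hφ]⟩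
    · rintro ⟨c, rfl⟩
      exact ⟨_, ⟨c, rfl⟩, by rw [hφ]⟩
  · rw [Set.sUnion_eq_iUnion]
    exact (f.symm.surjective.iUnion_comp (fun t : S => t.1)).symm

end

end ParikhAux

open ParikhAux in
/-- For context-free `L ⊆ w₁*⋯w_n*` there is a semilinear `U ⊆ ℕⁿ` mapped bijectively
onto `L` by `m ↦ w₁^{m₁}⋯w_n^{m_n}`. -/
theorem semilinear_bijection_onto_L {A : Type} [Fintype A] (n : ℕ) (w : Fin n → List A)
    (L : Language A) (hL : L.IsContextFree)
    (hsub : ∀ x ∈ L, ∃ m : Fin n → ℕ, x = (List.ofFn fun i => wpow (w i) (m i)).flatten) :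
    ∃ U : Set (Fin n → ℕ), IsSemilinear U ∧
      Set.BijOn (fun m => (List.ofFn fun i => wpow (w i) (m i)).flatten) U L := by
  change ∃ U : Set (Fin n → ℕ), IsSemilinear U ∧ Set.BijOn (gw w) U L
  obtain ⟨B, hB⟩ : ∃ B, ∀ i, (w i).length ≤ B :=
    ⟨Finset.univ.sup fun i => (w i).length, fun i =>
      Finset.le_sup (f := fun i => (w i).length) (Finset.mem_univ i)⟩
  have hfin : Finite {r : List A // r.length ≤ B} := (List.finite_length_le A B).to_subtype
  let s0 : St A n B := (0, ⟨[], by simp⟩)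
  let Acc : List A → (Fin n → ℕ) → Prop := fun x v =>
    ∃ q : St A n B, q.2.1 = [] ∧ v ∈ path (aut w B) x s0 q
  have hsound : ∀ x v, Acc x v → x = gw w v := by
    rintro x v ⟨q, hq, hv⟩
    simpa [s0] using (aut_sound w B x s0 q v hq hv).1
  have hcomp : ∀ m, ∃ v, Acc (gw w m) v := by
    intro m
    obtain ⟨v, q, hq, h⟩ := aut_complete w B hB _ m rfl [] (by simp) 0 (by simp)
    exact ⟨v, q, hq, h⟩
  let S2 : Set (Fin n ⊕ Fin n → ℕ) := {y | ∃ x ∈ L, Acc x (y ∘ Sum.inl) ∧ Acc x (y ∘ Sum.inr)}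
  have hS2 : IsSemilinearSet S2 := by
    have h := fun a b => semilinear_of_contextFree (fun (a : St A n B × St A n B) t b =>
      Set.image2 Sum.elim (aut w B a.1 t b.1) (aut w B a.2 t b.2))
      (fun p t q => .of_finite ((aut_finite w B _ t _).image2 _ (aut_finite w B _ t _))) L hL a b
    have h' := IsSemilinearSet.iUnion
      (fun q : {q : St A n B × St A n B // q.1.2.1 = [] ∧ q.2.2.1 = []} => h (s0, s0) q.1)
    convert h' using 1
    ext y
    obtain ⟨v, v', rfl⟩ : ∃ v v', y = Sum.elim v v' := ⟨_, _, (Sum.elim_comp_inl_inr y).symm⟩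
    simp only [Set.mem_iUnion, S2, Set.mem_ofPred_eq, Sum.elim_comp_inl, Sum.elim_comp_inr]
    constructor
    · rintro ⟨x, hx, ⟨q, hq, hv⟩, ⟨q', hq', hv'⟩⟩
      exact ⟨⟨(q, q'), hq, hq'⟩, x, hx, (mem_path_prod _ _ _ _ _ _ _ _).2 ⟨hv, hv'⟩⟩
    · rintro ⟨⟨⟨q, q'⟩, hq, hq'⟩, x, hx, h⟩
      obtain ⟨hv, hv'⟩ := (mem_path_prod _ _ _ _ _ _ _ _).1 h
      exact ⟨x, hx, ⟨q, hq, hv⟩, ⟨q', hq', hv'⟩⟩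
  let U : Set (Fin n → ℕ) := {v | ∃ v', Sum.elim v v' ∈ S2} \
    {v | ∃ v', Sum.elim v v' ∈ S2 ∩ {y : Fin n ⊕ Fin n → ℕ |
      ∃ i, (∀ j < i, y (.inr j) = y (.inl j)) ∧ y (.inr i) < y (.inl i)}}
  have hU : ∀ v, v ∈ U ↔ Acc (gw w v) v ∧ gw w v ∈ L ∧
      ∀ v', Acc (gw w v) v' → ¬ toLex v' < toLex v := by
    intro v
    constructor
    · rintro ⟨⟨v', x, hx, h1, h2⟩, h3⟩
      rw [Sum.elim_comp_inl] at h1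
      obtain rfl := hsound _ _ h1
      refine ⟨h1, hx, fun v'' h4 h5 => h3 ⟨v'', ⟨gw w v, hx, ?_, ?_⟩, ?_⟩⟩
      · rwa [Sum.elim_comp_inl]
      · rwa [Sum.elim_comp_inr]
      · obtain ⟨i, hi, hi'⟩ := h5
        exact ⟨i, hi, hi'⟩
    · rintro ⟨h1, h2, h3⟩
      refine ⟨⟨v, gw w v, h2, by rwa [Sum.elim_comp_inl], by rwa [Sum.elim_comp_inr]⟩, ?_⟩
      rintro ⟨v', ⟨x, hx, h4, h5⟩, i, hi, hi'⟩
      rw [Sum.elim_comp_inl] at h4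
      rw [Sum.elim_comp_inr] at h5
      obtain rfl := hsound _ _ h4
      exact h3 v' h5 ⟨i, hi, hi'⟩
  refine ⟨U, isSemilinear_of (IsSemilinearSet.sdiff (IsSemilinearSet.proj hS2)
    (IsSemilinearSet.proj (IsSemilinearSet.inter hS2 (semilinear_lex n)))), ?_, ?_, ?_⟩
  · intro v hv
    exact ((hU v).1 hv).2.1
  · intro v hv v' hv' h
    obtain ⟨h1, h2, h3⟩ := (hU v).1 hv
    obtain ⟨h1', h2', h3'⟩ := (hU v').1 hv'
    have ha := h3 v' (h ▸ h1')
    have hb := h3' v (h ▸ h1)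
    exact toLex.injective (le_antisymm (not_lt.1 ha) (not_lt.1 hb))
  · intro x hx
    obtain ⟨m, hm⟩ := hsub x hx
    change x = gw w m at hm
    obtain ⟨v0, hv0⟩ := hcomp m
    rw [← hm] at hv0
    obtain ⟨v, hv, hmin⟩ := WellFounded.has_min (wellFounded_lt (α := Lex (Fin n → ℕ)))
      {v | Acc x (ofLex v)} ⟨toLex v0, hv0⟩
    have hxv : x = gw w (ofLex v) := hsound _ _ hv
    refine ⟨ofLex v, (hU _).2 ⟨?_, ?_, ?_⟩, hxv.symm⟩
    · rw [← hxv]; exact hv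
    · rw [← hxv]; exact hx
    · intro v' hv' hlt
      rw [← hxv] at hv'
      exact hmin (toLex v') hv' hlt
end

section
/- For any alphabet Σ, the incomparability relation ∥ = {(u,v) ∈ Σ* × Σ* : u ⋢ v and v ⋢ u} with respect to the subword order is an unambiguous rational relation. -/
/-- `R ⊆ Σ* × Σ*` is unambiguous rational: there are an alphabet `Γ`, a regular language
`S ⊆ Γ*`, and a monoid homomorphism `h : Γ* → Σ* × Σ*` mapping `S` bijectively onto `R`. -/
def IsUnambRat {A : Type} (R : Set (List A × List A)) : Prop :=
  ∃ (Γ : Type) (_ : Fintype Γ) (S : Language Γ)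
    (h : FreeMonoid Γ →* FreeMonoid A × FreeMonoid A),
    S.IsRegular ∧
    Set.BijOn
      (fun wrd : List Γ =>
        (((h (FreeMonoid.ofList wrd)).1).toList, ((h (FreeMonoid.ofList wrd)).2).toList))
      S R

/-- The output alphabet of the encoding: a pair of letters, or a skipped letter on one side. -/
inductive IncLetter (A : Type) : Type
  | pair (a b : A)
  | skip (d : Bool) (b : A)

/-- States of the automaton (reading from right to left). -/
inductive IncState (A : Type) : Type
  | same
  | diff (a b : A)
  | skp (d : Bool) (a : A)
  | dead

namespace IncProof

noncomputable instance {A : Type} [Fintype A] : Fintype (IncLetter A) :=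
  @Fintype.ofSurjective _ _ (Classical.decEq _) inferInstance
    (fun x : (A × A) ⊕ (Bool × A) => match x with
      | .inl p => IncLetter.pair p.1 p.2
      | .inr p => IncLetter.skip p.1 p.2)
    (fun y => by
      classical
      cases y with
      | pair a b => exact ⟨.inl (a, b), rfl⟩
      | skip d b => exact ⟨.inr (d, b), rfl⟩)

noncomputable instance {A : Type} [Fintype A] : Fintype (IncState A) :=
  @Fintype.ofSurjective _ _ (Classical.decEq _) inferInstance
    (fun x : Bool ⊕ ((A × A) ⊕ (Bool × A)) => match x with
      | .inl true => IncState.same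
      | .inl false => IncState.dead
      | .inr (.inl p) => IncState.diff p.1 p.2
      | .inr (.inr p) => IncState.skp p.1 p.2)
    (fun y => by
      cases y with
      | same => exact ⟨.inl true, rfl⟩
      | dead => exact ⟨.inl false, rfl⟩
      | diff a b => exact ⟨.inr (.inl (a, b)), rfl⟩
      | skp d b => exact ⟨.inr (.inr (d, b)), rfl⟩)

variable {A : Type}

def out : IncLetter A → List A × List A
  | .pair a b => ([a], [b])
  | .skip true b => ([], [b])
  | .skip false a => ([a], [])

def outs : List (IncLetter A) → List A × List A
  | [] => ([], [])
  | x :: w => ((out x).1 ++ (outs w).1, (out x).2 ++ (outs w).2)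

variable [DecidableEq A]

def step : IncLetter A → IncState A → IncState A
  | .pair a b, .same => if a = b then .same else .diff a b
  | .pair a b, .diff _ _ => .diff a b
  | .pair a b, .skp d _ => if a = b then .skp d a else .dead
  | .skip true b, .diff a _ => if a = b then .dead else .skp true a
  | .skip false b, .diff _ a => if a = b then .dead else .skp false a
  | .skip e b, .skp d a => if e = d ∧ a ≠ b then .skp d a else .dead
  | _, _ => .dead

def state (w : List (IncLetter A)) : IncState A := w.foldr step .same

def dec : List A → List A → List (IncLetter A)
  | a :: u, b :: v =>
    if a = b then .pair a b :: dec u v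
    else if u.length = v.length then .pair a b :: dec u v
    else if u.length < v.length then .skip true b :: dec (a :: u) v
    else .skip false a :: dec u (b :: v)
  | _, _ => []
termination_by u v => u.length + v.length

/-- What a state says about the pair of words read so far. -/
def Inv : IncState A → List A → List A → Prop
  | .same, u, v => u = v
  | .diff a b, u, v => u.length = v.length ∧ u ≠ v ∧ (∃ u', u = a :: u') ∧ ∃ v', v = b :: v'
  | .skp true a, u, v => u.length < v.length ∧ ¬ u.Sublist v ∧ ∃ u', u = a :: u'
  | .skp false a, u, v => v.length < u.length ∧ ¬ v.Sublist u ∧ ∃ v', v = a :: v'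
  | .dead, _, _ => False

theorem sub_ne {a b : A} (h : a ≠ b) (u v : List A) :
    (a :: u).Sublist (b :: v) ↔ (a :: u).Sublist v := by
  constructor
  · intro hs
    cases hs with
    | cons _ h1 => exact h1
    | cons_cons _ h1 => exact absurd rfl h
  · exact fun hs => hs.cons _

theorem inv_state (w : List (IncLetter A)) (hw : state w ≠ .dead) :
    Inv (state w) (outs w).1 (outs w).2 ∧ dec (outs w).1 (outs w).2 = w := by
  induction w with
  | nil => simp [state, Inv, outs, dec]
  | cons x w ih =>
    have hs : state (x :: w) = step x (state w) := rfl
    rw [hs] at hw ⊢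
    have hd : state w ≠ .dead := by
      intro h
      rw [h] at hw
      apply hw
      cases x with
      | pair a b => rfl
      | skip d b => cases d <;> rfl
    obtain ⟨h1, h2⟩ := ih hd
    rcases hq : outs w with ⟨u, v⟩
    rw [hq] at h1 h2
    simp only at h1 h2
    have key : ∀ q, state w = q → Inv (step x (state w)) ((out x).1 ++ u) ((out x).2 ++ v) ∧
        dec ((out x).1 ++ u) ((out x).2 ++ v) = x :: w := by
      intro q hqq
      rw [hqq] at h1 hw ⊢
      rcases x with ⟨a, b⟩ | ⟨_ | _, b⟩ <;> rcases q with _ | ⟨c, d⟩ | ⟨_ | _, c⟩ | _ <;>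
        simp only [step, out, Inv, ne_eq, not_true_eq_false] at h1 hw ⊢
      · by_cases hab : a = b
        · simp_all [Inv, dec]
        · simp_all [Inv, dec]
      · obtain ⟨e1, e2, e3, e4⟩ := h1
        simp_all [Inv, dec]
      · by_cases hab : a = b
        · simp_all [Inv, dec]
        · simp_all
      · by_cases hab : a = b
        · simp_all [Inv, dec]
        · simp_all
      · by_cases hdb : d = b
        · simp [hdb] at hw
        obtain ⟨e1, e2, ⟨u', rfl⟩, ⟨v', rfl⟩⟩ := h1
        have hbd : ¬ b = d := fun h => hdb h.symm
        simp only [List.length_cons] at e1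
        have l1 : ¬ (u'.length + 1 = v'.length) := by omega
        have l2 : ¬ (u'.length + 1 < v'.length) := by omega
        refine ⟨?_, ?_⟩
        · simp only [hdb, if_false, Inv, List.nil_append, List.cons_append]
          refine ⟨by simp; omega, ?_, _, rfl⟩
          rw [sub_ne hdb]
          exact fun hs => e2 (hs.eq_of_length (by simp; omega)).symm
        · simp only [List.nil_append, List.cons_append]
          rw [dec]
          simp [hbd, l1, l2, h2]
      · by_cases hdb : c = b
        · simp [hdb] at hw
        obtain ⟨e1, e2, ⟨v', rfl⟩⟩ := h1
        have hbd : ¬ b = c := fun h => hdb h.symm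
        simp only [List.length_cons] at e1
        have l1 : ¬ (u.length = v'.length) := by omega
        have l2 : ¬ (u.length < v'.length) := by omega
        refine ⟨?_, ?_⟩
        · simp only [hdb, not_false_eq_true, and_self, if_true, Inv, List.nil_append,
            List.cons_append]
          refine ⟨by simp; omega, ?_, _, rfl⟩
          rw [sub_ne hdb]
          exact e2
        · simp only [List.nil_append, List.cons_append]
          rw [dec]
          simp [hbd, l1, l2, h2]
      · simp at hw
      · by_cases hdb : c = b
        · simp [hdb] at hw
        obtain ⟨e1, e2, ⟨u', rfl⟩, ⟨v', rfl⟩⟩ := h1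
        simp only [List.length_cons] at e1
        have l1 : ¬ (u'.length = v'.length + 1) := by omega
        have l2 : (u'.length < v'.length + 1) := by omega
        refine ⟨?_, ?_⟩
        · simp only [hdb, if_false, Inv, List.nil_append, List.cons_append]
          refine ⟨by simp; omega, ?_, _, rfl⟩
          rw [sub_ne hdb]
          exact fun hs => e2 (hs.eq_of_length (by simp; omega))
        · simp only [List.nil_append, List.cons_append]
          rw [dec]
          simp [hdb, l1, l2, h2]
      · simp at hw
      · by_cases hdb : c = b
        · simp [hdb] at hw
        obtain ⟨e1, e2, ⟨u', rfl⟩⟩ := h1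
        simp only [List.length_cons] at e1
        have l1 : ¬ (u'.length = v.length) := by omega
        have l2 : (u'.length < v.length) := by omega
        refine ⟨?_, ?_⟩
        · simp only [hdb, not_false_eq_true, and_self, if_true, Inv, List.nil_append,
            List.cons_append]
          refine ⟨by simp; omega, ?_, _, rfl⟩
          rw [sub_ne hdb]
          exact e2
        · simp only [List.nil_append, List.cons_append]
          rw [dec]
          simp [hdb, l1, l2, h2]
    simpa [outs, hq] using key _ rfl

theorem dec_spec (u v : List A) :
    (u = v → state (dec u v) = .same ∧ outs (dec u v) = (u, v)) ∧
    (u ≠ v → u.length = v.length → (∃ a b u' v', u = a :: u' ∧ v = b :: v' ∧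
      state (dec u v) = .diff a b) ∧ outs (dec u v) = (u, v)) ∧
    (u.length < v.length → ¬ u.Sublist v → (∃ a u', u = a :: u' ∧
      state (dec u v) = .skp true a) ∧ outs (dec u v) = (u, v)) ∧
    (v.length < u.length → ¬ v.Sublist u → (∃ a v', v = a :: v' ∧
      state (dec u v) = .skp false a) ∧ outs (dec u v) = (u, v)) := by
  have hst : ∀ (x : IncLetter A) w, state (x :: w) = step x (state w) := fun _ _ => rfl
  fun_induction dec u v with
  | case1 u b v ih =>
    obtain ⟨i1, i2, i3, i4⟩ := ih
    refine ⟨?_, ?_, ?_, ?_⟩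
    · intro h
      have h' : u = v := by simpa using h
      obtain ⟨j1, j2⟩ := i1 h'
      simp [hst, j1, j2, step, outs, out]
    · intro h hl
      obtain ⟨⟨c, d, u', v', e1, e2, j1⟩, j2⟩ := i2 (by simpa using h) (by simpa using hl)
      exact ⟨⟨b, b, u, v, rfl, rfl, by simp [hst, j1, step]⟩, by simp [outs, out, j2]⟩
    · intro hl h
      obtain ⟨⟨c, u', e1, j1⟩, j2⟩ := i3 (by simpa using hl) (by simpa using h)
      exact ⟨⟨b, u, rfl, by simp [hst, j1, step]⟩, by simp [outs, out, j2]⟩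
    · intro hl h
      obtain ⟨⟨c, u', e1, j1⟩, j2⟩ := i4 (by simpa using hl) (by simpa using h)
      exact ⟨⟨b, v, rfl, by simp [hst, j1, step]⟩, by simp [outs, out, j2]⟩
  | case2 a u b v hab hl ih =>
    obtain ⟨i1, i2, i3, i4⟩ := ih
    refine ⟨by simp [hab], ?_, by simp [hl], by simp [hl]⟩
    intro _ _
    by_cases huv : u = v
    · obtain ⟨j1, j2⟩ := i1 huv
      exact ⟨⟨a, b, u, v, rfl, rfl, by simp [hst, j1, step, hab]⟩, by simp [outs, out, j2]⟩
    · obtain ⟨⟨c, d, u', v', e1, e2, j1⟩, j2⟩ := i2 huv hl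
      exact ⟨⟨a, b, u, v, rfl, rfl, by simp [hst, j1, step]⟩, by simp [outs, out, j2]⟩
  | case3 a u b v hab hl hlt ih =>
    obtain ⟨i1, i2, i3, i4⟩ := ih
    refine ⟨by simp [hab], by simp [hl], ?_, by simp; omega⟩
    intro _ h
    rw [sub_ne hab] at h
    by_cases hl2 : (a :: u).length = v.length
    · have hne : a :: u ≠ v := by rintro rfl; exact h (List.Sublist.refl _)
      obtain ⟨⟨c, d, u', v', e1, e2, j1⟩, j2⟩ := i2 hne hl2
      obtain ⟨rfl, rfl⟩ := List.cons.inj e1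
      exact ⟨⟨a, u, rfl, by simp [hst, j1, step, hab]⟩, by simp [outs, out, j2]⟩
    · obtain ⟨⟨c, u', e1, j1⟩, j2⟩ := i3 (by simp at hl2 ⊢; omega) h
      obtain ⟨rfl, rfl⟩ := List.cons.inj e1
      exact ⟨⟨a, u, rfl, by simp [hst, j1, step, hab]⟩, by simp [outs, out, j2]⟩
  | case4 a u b v hab hl hlt ih =>
    obtain ⟨i1, i2, i3, i4⟩ := ih
    have hba : b ≠ a := fun h => hab h.symm
    refine ⟨by simp [hab], by simp [hl], by simp; omega, ?_⟩
    intro _ h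
    rw [sub_ne hba] at h
    by_cases hl2 : u.length = (b :: v).length
    · have hne : u ≠ b :: v := by rintro rfl; exact h (List.Sublist.refl _)
      obtain ⟨⟨c, d, u', v', e1, e2, j1⟩, j2⟩ := i2 hne hl2
      obtain ⟨rfl, rfl⟩ := List.cons.inj e2
      exact ⟨⟨b, v, rfl, by simp [hst, j1, step, hba]⟩, by simp [outs, out, j2]⟩
    · obtain ⟨⟨c, u', e1, j1⟩, j2⟩ := i4 (by simp at hl2 ⊢; omega) h
      obtain ⟨rfl, rfl⟩ := List.cons.inj e1
      exact ⟨⟨b, v, rfl, by simp [hst, j1, step, hba]⟩, by simp [outs, out, j2]⟩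
  | case5 u v hne =>
    rcases u with _ | ⟨a, u⟩
    · rcases v with _ | ⟨b, v⟩ <;> simp [state, outs]
    · rcases v with _ | ⟨b, v⟩
      · simp
      · exact (hne _ _ _ _ rfl rfl).elim

def acc : Set (IncState A) := {q | q ≠ .dead ∧ q ≠ .same}

def lang : Language (IncLetter A) := {w | state w ∈ acc}

theorem lang_regular [Fintype A] : (lang : Language (IncLetter A)).IsRegular := by
  have h : (lang : Language (IncLetter A)).reverse.IsRegular := by
    refine ⟨IncState A, inferInstance, ⟨fun q x => step x q, .same, acc⟩, ?_⟩
    ext w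
    rw [Language.mem_reverse, DFA.mem_accepts]
    change w.foldl (fun q x => step x q) .same ∈ acc ↔ w.reverse.foldr step .same ∈ acc
    rw [List.foldr_reverse]
  simpa using h.reverse

theorem inv_acc {q : IncState A} {u v : List A} (h : Inv q u v) (hq : q ∈ acc) :
    ¬ u.Sublist v ∧ ¬ v.Sublist u := by
  rcases q with _ | ⟨c, d⟩ | ⟨_ | _, c⟩ | _ <;> simp only [Inv] at h
  · simp [acc] at hq
  · exact ⟨fun hs => h.2.1 (hs.eq_of_length h.1), fun hs => h.2.1 (hs.eq_of_length h.1.symm).symm⟩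
  · exact ⟨fun hs => by have := hs.length_le; omega, h.2.1⟩
  · exact ⟨h.2.1, fun hs => by have := hs.length_le; omega⟩

theorem dec_acc {u v : List A} (h1 : ¬ u.Sublist v) (h2 : ¬ v.Sublist u) :
    state (dec u v) ∈ (acc : Set (IncState A)) ∧ outs (dec u v) = (u, v) := by
  obtain ⟨_, s2, s3, s4⟩ := dec_spec u v
  rcases lt_trichotomy u.length v.length with h | h | h
  · obtain ⟨⟨a, u', _, e⟩, e'⟩ := s3 h h1
    exact ⟨by simp [acc, e], e'⟩
  · have hne : u ≠ v := by rintro rfl; exact h1 (List.Sublist.refl _)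
    obtain ⟨⟨a, b, u', v', _, _, e⟩, e'⟩ := s2 hne h
    exact ⟨by simp [acc, e], e'⟩
  · obtain ⟨⟨a, u', _, e⟩, e'⟩ := s4 h h2
    exact ⟨by simp [acc, e], e'⟩

end IncProof

/-- The incomparability relation of the subword order is unambiguous rational. -/
theorem incomparability_isUnambRat {A : Type} [Fintype A] :
    IsUnambRat {p : List A × List A | ¬ p.1.Sublist p.2 ∧ ¬ p.2.Sublist p.1} := by
  classical
  refine ⟨IncLetter A, inferInstance, IncProof.lang,
    FreeMonoid.lift fun x => (FreeMonoid.ofList (IncProof.out x).1,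
      FreeMonoid.ofList (IncProof.out x).2), IncProof.lang_regular, ?_⟩
  have hf : (fun wrd : List (IncLetter A) =>
      ((((FreeMonoid.lift fun x : IncLetter A => (FreeMonoid.ofList (IncProof.out x).1,
      FreeMonoid.ofList (IncProof.out x).2)) (FreeMonoid.ofList wrd)).1).toList,
      (((FreeMonoid.lift fun x : IncLetter A => (FreeMonoid.ofList (IncProof.out x).1,
      FreeMonoid.ofList (IncProof.out x).2)) (FreeMonoid.ofList wrd)).2).toList)) =
      IncProof.outs := by
    funext w
    induction w with
    | nil => simp [IncProof.outs]
    | cons x w ih =>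
      rw [IncProof.outs, ← ih, FreeMonoid.ofList_cons, map_mul]
      simp
  rw [hf]
  refine Set.InvOn.bijOn (f' := fun p => IncProof.dec p.1 p.2) ⟨?_, ?_⟩ ?_ ?_
  · intro w hw
    exact (IncProof.inv_state w hw.1).2
  · intro p hp
    exact (IncProof.dec_acc hp.1 hp.2).2
  · intro w hw
    exact IncProof.inv_acc (IncProof.inv_state w hw.1).1 hw
  · intro p hp
    exact (IncProof.dec_acc hp.1 hp.2).1
end
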